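/- arXiv:1811.11227 — 2 statements merged into one kernel-verified Lean document; each statement's English description precedes it below -/
import Mathlib

section
/- Let L be an integral hermitian O_H-lattice with a fixed Jordan splitting, and define n_odd, n_even and t(L) from this splitting. Assume at least one of the following holds: (1) n_even ≥ 3, or n_even = 2 and L_{≥2} is split; (2) n_odd ≥ 2. Then there exist two distinct lattices Λ_1 ≠ Λ_2 in Vert(L) with t(Λ_1) = t(Λ_2) = t(L). -/
/- Common setup: ramified quadratic extension H/ℚ_p, ring of integers O_H,
   hermitian forms, lattices, duals, vertex lattices. -/

open scoped Classical

noncomputable section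

namespace Ramified

/-- The ring of integers of `H`: the integral closure of `ℤ_p` in `H`. -/
def OH (p : ℕ) [Fact (Nat.Prime p)] (H : Type) [Field H] [Algebra ℚ_[p] H] : Subring H :=
  letI : Algebra ℤ_[p] H := ((algebraMap ℚ_[p] H).comp PadicInt.Coe.ringHom).toAlgebra
  (integralClosure ℤ_[p] H).toSubring

/-- `H/ℚ_p` is a ramified quadratic extension with nontrivial Galois automorphism `conj`
and uniformizer `ϖ` satisfying `conj ϖ = -ϖ` and `ϖ² = π₀` a uniformizer of `ℤ_p`. -/
structure IsRamifiedQuadratic (p : ℕ) [Fact (Nat.Prime p)] (H : Type) [Field H]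
    [Algebra ℚ_[p] H] (conj : H ≃+* H) (ϖ : H) : Prop where
  conj_conj : ∀ x : H, conj (conj x) = x
  conj_fix : ∀ q : ℚ_[p], conj (algebraMap ℚ_[p] H q) = algebraMap ℚ_[p] H q
  conj_ne : conj ≠ RingEquiv.refl H
  dim_two : Module.finrank ℚ_[p] H = 2
  conj_unif : conj ϖ = -ϖ
  unif_sq : ∃ u : ℤ_[p]ˣ, ϖ * ϖ = algebraMap ℚ_[p] H ((u : ℤ_[p]) : ℚ_[p]) * (p : H)

variable {p : ℕ} [Fact (Nat.Prime p)] {H : Type} [Field H] [Algebra ℚ_[p] H]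

/-- Any `H`-module is an `O_H`-module by restriction of scalars. -/
instance moduleOH (C : Type) [AddCommGroup C] [Module H C] : Module (OH p H) C :=
  Module.compHom C (OH p H).subtype

variable {C : Type} [AddCommGroup C] [Module H C]

theorem oh_smul_def (c : OH p H) (x : C) : c • x = (c : H) • x := rfl

/-- A hermitian form on `C` with respect to the conjugation `conj` of `H`:
linear in the first variable, conjugate-symmetric. -/
structure HermForm (H : Type) [Field H] (C : Type) [AddCommGroup C] [Module H C]
    (conj : H ≃+* H) where
  form : C → C → H
  form_add : ∀ x y z : C, form (x + y) z = form x z + form y z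
  form_smul : ∀ (a : H) (x y : C), form (a • x) y = a * form x y
  form_conj : ∀ x y : C, form y x = conj (form x y)

variable {conj : H ≃+* H}

theorem HermForm.form_zero (φ : HermForm H C conj) (y : C) : φ.form 0 y = 0 := by
  have h := φ.form_smul (0 : H) 0 y
  simpa using h

/-- The dual lattice `Λ♯ = {x : C | φ(x, Λ) ⊆ O_H}`. -/
def HermForm.dual (φ : HermForm H C conj) (Λ : Submodule (OH p H) C) :
    Submodule (OH p H) C where
  carrier := {x : C | ∀ y ∈ Λ, φ.form x y ∈ OH p H}
  add_mem' := by
    intro a b ha hb y hy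
    rw [φ.form_add]
    exact add_mem (ha y hy) (hb y hy)
  zero_mem' := by
    intro y hy
    rw [HermForm.form_zero]
    exact zero_mem _
  smul_mem' := by
    intro c x hx y hy
    show φ.form ((c : H) • x) y ∈ OH p H
    rw [φ.form_smul]
    exact mul_mem c.2 (hx y hy)

/-- The orthogonal complement (in `C = L ⊗ H`) of a sublattice. -/
def HermForm.orthog (φ : HermForm H C conj) (N : Submodule (OH p H) C) :
    Submodule (OH p H) C where
  carrier := {x : C | ∀ y ∈ N, φ.form x y = 0}
  add_mem' := by
    intro a b ha hb y hy
    rw [φ.form_add, ha y hy, hb y hy, add_zero]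
  zero_mem' := by
    intro y hy
    rw [HermForm.form_zero]
  smul_mem' := by
    intro c x hx y hy
    show φ.form ((c : H) • x) y = 0
    rw [φ.form_smul, hx y hy, mul_zero]

/-- Scalar multiplication by `a : H`, as an `O_H`-linear map. -/
def smulMap (a : H) : C →ₗ[OH p H] C where
  toFun x := a • x
  map_add' x y := smul_add a x y
  map_smul' c x := by
    show a • ((c : H) • x) = (c : H) • (a • x)
    rw [smul_comm]

/-- The lattice `a • Λ` for a scalar `a : H`. -/
def scale (a : H) (Λ : Submodule (OH p H) C) : Submodule (OH p H) C :=
  Λ.map (smulMap a)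

/-- An `H`-subspace of `C`, viewed as an `O_H`-submodule. -/
def restrictOH (W : Submodule H C) : Submodule (OH p H) C where
  carrier := (W : Set C)
  add_mem' := fun ha hb => W.add_mem ha hb
  zero_mem' := W.zero_mem
  smul_mem' := fun c x hx => W.smul_mem (c : H) hx

/-- The cardinality of the quotient `Λ/N` (for `N ⊆ Λ` this is the usual quotient). -/
def quotCard (N Λ : Submodule (OH p H) C) : ℕ :=
  Nat.card (Λ ⧸ N.comap Λ.subtype)

/-- A (full) `O_H`-lattice in `C`: finitely generated and spanning `C` over `H`. -/
def IsLattice (Λ : Submodule (OH p H) C) : Prop :=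
  Λ.FG ∧ Submodule.span H (Λ : Set C) = ⊤

/-- A vertex lattice: a full lattice with `ϖΛ ⊆ Λ♯ ⊆ Λ`. -/
def IsVertexLattice (φ : HermForm H C conj) (ϖ : H) (Λ : Submodule (OH p H) C) : Prop :=
  IsLattice Λ ∧ scale ϖ Λ ≤ φ.dual Λ ∧ φ.dual Λ ≤ Λ

/-- `Λ ∈ Vert(L)`: a vertex lattice with `L ⊆ Λ♯`. -/
def InVert (φ : HermForm H C conj) (ϖ : H) (L Λ : Submodule (OH p H) C) : Prop :=
  IsVertexLattice φ ϖ Λ ∧ L ≤ φ.dual Λ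

/-- `M` is `a`-modular (e.g. `a = ϖ^i`): `(x, M) = a·O_H` for every maximal `x ∈ M`. -/
def IsPiModular (φ : HermForm H C conj) (ϖ a : H) (M : Submodule (OH p H) C) : Prop :=
  ∀ x ∈ M, x ∉ scale ϖ M →
    (fun y => φ.form x y) '' (M : Set C) = (fun c => a * c) '' ((OH p H : Set H))

/-- `N` is split: an orthogonal direct sum of hyperbolic planes `H(i)`. -/
def IsSplitLat (φ : HermForm H C conj) (ϖ : H) (N : Submodule (OH p H) C) : Prop :=
  ∃ (s : ℕ) (e f : Fin s → C) (d : Fin s → ℕ),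
    N = Submodule.span (OH p H) (Set.range e ∪ Set.range f) ∧
    (∀ j, φ.form (e j) (e j) = 0 ∧ φ.form (f j) (f j) = 0 ∧
      φ.form (e j) (f j) = ϖ ^ d j) ∧
    ∀ j j', j ≠ j' → φ.form (e j) (e j') = 0 ∧ φ.form (e j) (f j') = 0 ∧
      φ.form (f j) (e j') = 0 ∧ φ.form (f j) (f j') = 0

/-- The `O_H`-rank of a sublattice of `C` (the dimension of the subspace it spans). -/
def rk (N : Submodule (OH p H) C) : ℕ :=
  Module.finrank H (Submodule.span H (N : Set C))

/-- A Jordan splitting `L = ⊕_{0 ≤ λ ≤ k} L_λ` with `L_λ` being `ϖ^λ`-modular (or zero). -/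
structure JordanSplitting (φ : HermForm H C conj) (ϖ : H) (L : Submodule (OH p H) C)
    (k : ℕ) (Lc : ℕ → Submodule (OH p H) C) : Prop where
  sup_eq : L = ⨆ i ∈ Finset.range (k + 1), Lc i
  bot_of_gt : ∀ i, k < i → Lc i = ⊥
  disj : ∀ i ∈ Finset.range (k + 1),
    Disjoint (Lc i) (⨆ j ∈ (Finset.range (k + 1)).erase i, Lc j)
  orthog : ∀ i j, i ≠ j → ∀ x ∈ Lc i, ∀ y ∈ Lc j, φ.form x y = 0
  modular : ∀ i ∈ Finset.range (k + 1), Lc i ≠ ⊥ → IsPiModular φ ϖ (ϖ ^ i) (Lc i)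

/-- `L_{≥ t} = ⊕_{λ ≥ t} L_λ`. -/
def Lge (Lc : ℕ → Submodule (OH p H) C) (k t : ℕ) : Submodule (OH p H) C :=
  ⨆ i ∈ Finset.Icc t k, Lc i

/-- `m(L) = rank_{O_H} L_{≥1}`. -/
def mOf (Lc : ℕ → Submodule (OH p H) C) (k : ℕ) : ℕ :=
  ∑ i ∈ Finset.Icc 1 k, rk (Lc i)

/-- The invariant `t(L)` from Theorem A. -/
def tOf (φ : HermForm H C conj) (ϖ : H) (Lc : ℕ → Submodule (OH p H) C) (k : ℕ) : ℕ :=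
  if Odd (mOf Lc k) then mOf Lc k - 1
  else if IsSplitLat φ ϖ (Lge Lc k 1) then mOf Lc k
  else mOf Lc k - 2

/-- `n_odd = Σ_{λ ≥ 3, λ odd} rank L_λ`. -/
def nOdd (Lc : ℕ → Submodule (OH p H) C) (k : ℕ) : ℕ :=
  ∑ i ∈ (Finset.Icc 3 k).filter (fun i => Odd i), rk (Lc i)

/-- `n_even = Σ_{λ ≥ 2, λ even} rank L_λ`. -/
def nEven (Lc : ℕ → Submodule (OH p H) C) (k : ℕ) : ℕ :=
  ∑ i ∈ (Finset.Icc 2 k).filter (fun i => Even i), rk (Lc i)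

end Ramified

namespace Ramified

section FieldTheory

variable {p : ℕ} [Fact (Nat.Prime p)] {H : Type} [Field H] [Algebra ℚ_[p] H]
  {conj : H ≃+* H} {ϖ : H}

theorem one_lt_cast_prime (p : ℕ) [Fact (Nat.Prime p)] : (1 : ℝ) < p := by
  exact_mod_cast (Fact.out : p.Prime).one_lt

theorem cast_prime_pos (p : ℕ) [Fact (Nat.Prime p)] : (0 : ℝ) < p :=
  zero_lt_one.trans (one_lt_cast_prime p)

/-- The value `p ^ (-n)` of the normalized absolute value at the `n`-th power of a uniformizer. -/
def lev (p : ℕ) (n : ℤ) : ℝ := (p : ℝ) ^ (-n)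

theorem lev_pos (p : ℕ) [Fact (Nat.Prime p)] (n : ℤ) : 0 < lev p n :=
  zpow_pos (cast_prime_pos p) _

theorem lev_zero (p : ℕ) : lev p 0 = 1 := by simp [lev]

theorem lev_add (p : ℕ) [Fact (Nat.Prime p)] (m n : ℤ) : lev p (m + n) = lev p m * lev p n := by
  unfold lev
  rw [neg_add, zpow_add₀ (cast_prime_pos p).ne']

theorem lev_le_iff (p : ℕ) [Fact (Nat.Prime p)] {m n : ℤ} : lev p m ≤ lev p n ↔ n ≤ m := by
  unfold lev
  rw [zpow_le_zpow_iff_right₀ (one_lt_cast_prime p)]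
  omega

theorem lev_lt_iff (p : ℕ) [Fact (Nat.Prime p)] {m n : ℤ} : lev p m < lev p n ↔ n < m := by
  rw [← not_le, lev_le_iff, not_le]

theorem lev_inj (p : ℕ) [Fact (Nat.Prime p)] {m n : ℤ} : lev p m = lev p n ↔ m = n := by
  rw [le_antisymm_iff, lev_le_iff, lev_le_iff]
  omega

namespace IsRamifiedQuadratic

theorem charZero (_hram : IsRamifiedQuadratic p H conj ϖ) : CharZero H :=
  charZero_of_injective_algebraMap (algebraMap ℚ_[p] H).injective

/-- The square of the uniformizer, as an element of `ℚ_p`. -/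
theorem exists_sq (hram : IsRamifiedQuadratic p H conj ϖ) :
    ∃ c : ℚ_[p], ϖ * ϖ = algebraMap ℚ_[p] H c ∧ ‖c‖ = lev p 1 := by
  obtain ⟨u, hu⟩ := hram.unif_sq
  refine ⟨((u : ℤ_[p]) : ℚ_[p]) * p, by rw [hu, map_mul, map_natCast], ?_⟩
  have h1 : ‖((u : ℤ_[p]) : ℚ_[p])‖ = 1 := PadicInt.norm_units u
  rw [norm_mul, h1, one_mul, Padic.norm_p, lev, zpow_neg_one]

theorem pi_ne_zero (hram : IsRamifiedQuadratic p H conj ϖ) : ϖ ≠ 0 := by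
  obtain ⟨c, hc, hn⟩ := hram.exists_sq
  rintro rfl
  have : c = 0 := (algebraMap ℚ_[p] H).injective (by rw [← hc]; simp)
  rw [this, norm_zero] at hn
  exact (lev_pos p 1).ne hn

theorem exists_coords (hram : IsRamifiedQuadratic p H conj ϖ) (x : H) :
    ∃ a b : ℚ_[p], x = algebraMap ℚ_[p] H a + algebraMap ℚ_[p] H b * ϖ := by
  have := hram.charZero
  have hli : LinearIndependent ℚ_[p] ![(1 : H), ϖ] := by
    rw [LinearIndependent.pair_iff]
    intro a b hab
    simp only [Algebra.smul_def, mul_one] at hab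
    have h2 := congrArg conj hab
    rw [map_add, map_mul, hram.conj_fix, hram.conj_fix, hram.conj_unif, map_zero] at h2
    have ha : algebraMap ℚ_[p] H a = 0 := by linear_combination (hab + h2) / 2
    have hb : algebraMap ℚ_[p] H b * ϖ = 0 := by rw [ha, zero_add] at hab; exact hab
    have hb' : algebraMap ℚ_[p] H b = 0 := (mul_eq_zero.1 hb).resolve_right hram.pi_ne_zero
    exact ⟨by simpa using ha, by simpa using hb'⟩
  have htop := hli.span_eq_top_of_card_eq_finrank (by simp [hram.dim_two])
  have hx : x ∈ Submodule.span ℚ_[p] (Set.range ![(1 : H), ϖ]) := htop ▸ Submodule.mem_top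
  rw [Matrix.range_cons, Matrix.range_cons, Matrix.range_empty, Set.union_empty,
    Set.singleton_union, Submodule.mem_span_pair] at hx
  obtain ⟨a, b, h⟩ := hx
  exact ⟨a, b, by simp [← h, Algebra.smul_def]⟩

theorem exists_norm (hram : IsRamifiedQuadratic p H conj ϖ) (x : H) :
    ∃ q : ℚ_[p], algebraMap ℚ_[p] H q = x * conj x := by
  obtain ⟨a, b, rfl⟩ := hram.exists_coords x
  obtain ⟨c, hc, -⟩ := hram.exists_sq
  refine ⟨a * a - b * b * c, ?_⟩
  simp only [map_sub, map_mul, map_add, hram.conj_fix, hram.conj_unif, ← hc]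
  ring

/-- The absolute value `|x| = |N(x)|_p` on `H`. -/
def nu (hram : IsRamifiedQuadratic p H conj ϖ) (x : H) : ℝ := ‖(hram.exists_norm x).choose‖


theorem nu_eq
    (hram : IsRamifiedQuadratic p H conj ϖ)
    {x : H} {q : ℚ_[p]} (h : algebraMap ℚ_[p] H q = x * conj x) : hram.nu x = ‖q‖ := by
  have h2 := (hram.exists_norm x).choose_spec
  rw [nu, (algebraMap ℚ_[p] H).injective (h2.trans h.symm)]

theorem nu_nonneg
    (hram : IsRamifiedQuadratic p H conj ϖ) (x : H) : 0 ≤ hram.nu x := norm_nonneg _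

theorem nu_mul
    (hram : IsRamifiedQuadratic p H conj ϖ)
    (x y : H) : hram.nu (x * y) = hram.nu x * hram.nu y := by
  obtain ⟨a, ha⟩ := hram.exists_norm x
  obtain ⟨b, hb⟩ := hram.exists_norm y
  rw [hram.nu_eq ha, hram.nu_eq hb, ← norm_mul]
  apply hram.nu_eq
  rw [map_mul, map_mul, ha, hb]
  ring

theorem nu_conj
    (hram : IsRamifiedQuadratic p H conj ϖ) (x : H) : hram.nu (conj x) = hram.nu x := by
  obtain ⟨a, ha⟩ := hram.exists_norm x
  rw [hram.nu_eq ha]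
  apply hram.nu_eq
  rw [ha, hram.conj_conj, mul_comm]

theorem nu_algebraMap
    (hram : IsRamifiedQuadratic p H conj ϖ)
    (q : ℚ_[p]) : hram.nu (algebraMap ℚ_[p] H q) = ‖q‖ ^ 2 := by
  rw [← norm_pow]
  apply hram.nu_eq
  rw [hram.conj_fix, map_pow, sq]

theorem nu_zero
    (hram : IsRamifiedQuadratic p H conj ϖ) : hram.nu 0 = 0 := by
  simpa using hram.nu_algebraMap 0

theorem nu_one
    (hram : IsRamifiedQuadratic p H conj ϖ) : hram.nu 1 = 1 := by
  simpa using hram.nu_algebraMap 1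

theorem nu_neg
    (hram : IsRamifiedQuadratic p H conj ϖ) (x : H) : hram.nu (-x) = hram.nu x := by
  have h := hram.nu_algebraMap (-1)
  rw [neg_eq_neg_one_mul, hram.nu_mul]
  simp at h
  rw [h, one_mul]

theorem nu_pi
    (hram : IsRamifiedQuadratic p H conj ϖ) : hram.nu ϖ = lev p 1 := by
  obtain ⟨c, hc, hn⟩ := hram.exists_sq
  rw [← hn, ← norm_neg]
  apply hram.nu_eq
  rw [hram.conj_unif, map_neg, ← hc]
  ring

theorem norm_sq_eq_lev {a : ℚ_[p]} (ha : a ≠ 0) : ∃ m : ℤ, ‖a‖ ^ 2 = lev p (2 * m) := by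
  refine ⟨a.valuation, ?_⟩
  rw [Padic.norm_eq_zpow_neg_valuation ha, lev, ← zpow_natCast, ← zpow_mul]
  congr 1
  push_cast
  ring

theorem nu_coords
    (hram : IsRamifiedQuadratic p H conj ϖ) (a b : ℚ_[p]) :
    hram.nu (algebraMap ℚ_[p] H a + algebraMap ℚ_[p] H b * ϖ) =
      max (‖a‖ ^ 2) (‖b‖ ^ 2 * lev p 1) := by
  obtain ⟨c, hc, hn⟩ := hram.exists_sq
  have h1 : hram.nu (algebraMap ℚ_[p] H a + algebraMap ℚ_[p] H b * ϖ) =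
      ‖a ^ 2 + -(b ^ 2 * c)‖ := by
    apply hram.nu_eq
    simp only [map_neg, map_mul, map_add, map_pow, hram.conj_fix, hram.conj_unif, ← hc]
    ring
  rw [h1]
  by_cases ha : a = 0
  · subst ha
    simp [norm_mul, hn]
    positivity [lev_pos p 1]
  by_cases hb : b = 0
  · subst hb
    simp
  rw [Padic.add_eq_max_of_ne, norm_neg, norm_mul, norm_pow, norm_pow, hn]
  rw [norm_neg, norm_mul, norm_pow, norm_pow, hn]
  obtain ⟨m, hm⟩ := norm_sq_eq_lev ha
  obtain ⟨k, hk⟩ := norm_sq_eq_lev hb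
  rw [hm, hk, ← lev_add, Ne, lev_inj]
  omega

theorem nu_add_le
    (hram : IsRamifiedQuadratic p H conj ϖ)
    (x y : H) : hram.nu (x + y) ≤ max (hram.nu x) (hram.nu y) := by
  obtain ⟨a, b, rfl⟩ := hram.exists_coords x
  obtain ⟨a', b', rfl⟩ := hram.exists_coords y
  have h : algebraMap ℚ_[p] H a + algebraMap ℚ_[p] H b * ϖ +
      (algebraMap ℚ_[p] H a' + algebraMap ℚ_[p] H b' * ϖ) =
      algebraMap ℚ_[p] H (a + a') + algebraMap ℚ_[p] H (b + b') * ϖ := by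
    simp only [map_add]
    ring
  have key : ∀ u v : ℚ_[p], ‖u + v‖ ^ 2 ≤ max (‖u‖ ^ 2) (‖v‖ ^ 2) := by
    intro u v
    have h0 := Padic.nonarchimedean u v
    rcases le_max_iff.1 h0 with h1 | h1
    · exact le_max_of_le_left (pow_le_pow_left₀ (norm_nonneg _) h1 2)
    · exact le_max_of_le_right (pow_le_pow_left₀ (norm_nonneg _) h1 2)
  rw [h, hram.nu_coords, hram.nu_coords, hram.nu_coords]
  have hp := lev_pos p 1
  apply max_le
  · rcases le_max_iff.1 (key a a') with h1 | h1
    · exact le_max_of_le_left (le_max_of_le_left h1)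
    · exact le_max_of_le_right (le_max_of_le_left h1)
  · rcases le_max_iff.1 (key b b') with h1 | h1
    · exact le_max_of_le_left (le_max_of_le_right (mul_le_mul_of_nonneg_right h1 hp.le))
    · exact le_max_of_le_right (le_max_of_le_right (mul_le_mul_of_nonneg_right h1 hp.le))

theorem nu_add_le_of_le
    (hram : IsRamifiedQuadratic p H conj ϖ)
    {x y : H} {r : ℝ} (hx : hram.nu x ≤ r) (hy : hram.nu y ≤ r) :
    hram.nu (x + y) ≤ r :=
  (hram.nu_add_le x y).trans (max_le hx hy)

theorem exists_lev
    (hram : IsRamifiedQuadratic p H conj ϖ)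
    {x : H} (hx : x ≠ 0) : ∃ n : ℤ, hram.nu x = lev p n := by
  obtain ⟨q, hq⟩ := hram.exists_norm x
  have hq0 : q ≠ 0 := by
    rintro rfl
    rw [map_zero, eq_comm, mul_eq_zero, map_eq_zero_iff conj conj.injective] at hq
    tauto
  exact ⟨q.valuation, by rw [hram.nu_eq hq, Padic.norm_eq_zpow_neg_valuation hq0, lev]⟩

theorem ne_zero_of_nu
    (hram : IsRamifiedQuadratic p H conj ϖ) {x : H} {n : ℤ} (h : hram.nu x = lev p n) : x ≠ 0 := by
  rintro rfl
  rw [hram.nu_zero] at h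
  exact (lev_pos p n).ne h

theorem nu_inv
    (hram : IsRamifiedQuadratic p H conj ϖ) (x : H) : hram.nu x⁻¹ = (hram.nu x)⁻¹ := by
  by_cases hx : x = 0
  · simp [hx, hram.nu_zero]
  · apply eq_inv_of_mul_eq_one_left
    rw [← hram.nu_mul, inv_mul_cancel₀ hx, hram.nu_one]

theorem nu_pow
    (hram : IsRamifiedQuadratic p H conj ϖ) (x : H) (n : ℕ) : hram.nu (x ^ n) = hram.nu x ^ n := by
  induction n with
  | zero => simp [hram.nu_one]
  | succ n ih => rw [pow_succ, hram.nu_mul, ih, pow_succ]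

theorem nu_pi_zpow
    (hram : IsRamifiedQuadratic p H conj ϖ) (n : ℤ) : hram.nu (ϖ ^ n) = lev p n := by
  have hpos := cast_prime_pos p
  have h0 : ∀ n : ℕ, hram.nu (ϖ ^ n) = lev p n := by
    intro n
    rw [hram.nu_pow, hram.nu_pi, lev, lev, ← zpow_natCast, ← zpow_mul]
    congr 1
    ring
  obtain ⟨m, rfl | rfl⟩ := n.eq_nat_or_neg
  · rw [zpow_natCast, h0]
  · rw [zpow_neg, zpow_natCast, hram.nu_inv, h0, lev, lev, ← zpow_neg]

theorem mem_OH_iff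
    (hram : IsRamifiedQuadratic p H conj ϖ) (x : H) : x ∈ OH p H ↔ hram.nu x ≤ 1 := by
  let : Algebra ℤ_[p] H := ((algebraMap ℚ_[p] H).comp PadicInt.Coe.ringHom).toAlgebra
  have : IsScalarTower ℤ_[p] ℚ_[p] H := IsScalarTower.of_algebraMap_eq fun _ => rfl
  have hdef : x ∈ OH p H ↔ IsIntegral ℤ_[p] x := Iff.rfl
  have hmap : ∀ z : ℤ_[p], algebraMap ℤ_[p] H z = algebraMap ℚ_[p] H (z : ℚ_[p]) := fun _ => rfl
  rw [hdef]
  constructor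
  · intro hx
    let c : H →ₐ[ℤ_[p]] H := { (conj : H →+* H) with
      commutes' := fun z => by
        show conj (algebraMap ℤ_[p] H z) = _
        rw [hmap, hram.conj_fix] }
    have hc : IsIntegral ℤ_[p] (conj x) := hx.map c
    obtain ⟨q, hq⟩ := hram.exists_norm x
    have h1 : IsIntegral ℤ_[p] (algebraMap ℚ_[p] H q) := hq ▸ hx.mul hc
    have h2 : IsIntegral ℤ_[p] q :=
      (isIntegral_algebraMap_iff (algebraMap ℚ_[p] H).injective).1 h1
    obtain ⟨z, hz⟩ := IsIntegrallyClosed.isIntegral_iff.1 h2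
    rw [hram.nu_eq hq, ← hz]
    exact z.2
  · intro hx
    obtain ⟨a, b, rfl⟩ := hram.exists_coords x
    rw [hram.nu_coords] at hx
    have ha2 := (le_max_left _ _).trans hx
    have hb2 := (le_max_right _ _).trans hx
    have ha : ‖a‖ ≤ 1 := by
      by_contra h
      push Not at h
      nlinarith
    have hb : ‖b‖ ≤ 1 := by
      by_cases hb0 : b = 0
      · simp [hb0]
      obtain ⟨k, hk⟩ := norm_sq_eq_lev hb0
      rw [hk, ← lev_add, ← lev_zero p, lev_le_iff] at hb2
      have h3 : lev p (2 * k) ≤ lev p 0 := (lev_le_iff p).2 (by omega)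
      rw [← hk, lev_zero] at h3
      by_contra h
      push Not at h
      nlinarith
    obtain ⟨c, hc, hn⟩ := hram.exists_sq
    have hcn : ‖c‖ ≤ 1 := by
      rw [hn, ← lev_zero p, lev_le_iff]
      omega
    have hcoe : ∀ q : ℚ_[p], ‖q‖ ≤ 1 → IsIntegral ℤ_[p] (algebraMap ℚ_[p] H q) := fun q hq =>
      isIntegral_algebraMap (R := ℤ_[p]) (x := (⟨q, hq⟩ : ℤ_[p]))
    have hpi : IsIntegral ℤ_[p] ϖ := by
      apply IsIntegral.of_pow (n := 2) (by norm_num)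
      rw [sq, hc]
      exact hcoe c hcn
    exact (hcoe a ha).add ((hcoe b hb).mul hpi)

theorem coe_le
    (hram : IsRamifiedQuadratic p H conj ϖ)
    (c : OH p H) : hram.nu (c : H) ≤ 1 := (hram.mem_OH_iff _).1 c.2

theorem pi_mem
    (hram : IsRamifiedQuadratic p H conj ϖ) : ϖ ∈ OH p H := by
  rw [hram.mem_OH_iff, hram.nu_pi, ← lev_zero p, lev_le_iff]
  omega

theorem conj_pi_zpow
    (hram : IsRamifiedQuadratic p H conj ϖ) (n : ℤ) : conj (ϖ ^ n) = (-1) ^ n * ϖ ^ n := by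
  rw [map_zpow₀, hram.conj_unif, neg_eq_neg_one_mul, mul_zpow]

theorem exists_of_conj_eq
    (hram : IsRamifiedQuadratic p H conj ϖ)
    {x : H} (hx : conj x = x) : ∃ a : ℚ_[p], x = algebraMap ℚ_[p] H a := by
  have := hram.charZero
  obtain ⟨a, b, rfl⟩ := hram.exists_coords x
  rw [map_add, map_mul, hram.conj_fix, hram.conj_fix, hram.conj_unif] at hx
  refine ⟨a, ?_⟩
  have h : algebraMap ℚ_[p] H b * ϖ = 0 := by linear_combination -hx / 2
  rw [h, add_zero]

theorem even_of_conj_eq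
    (hram : IsRamifiedQuadratic p H conj ϖ)
    {x : H} (hx : conj x = x) {n : ℤ} (hn : hram.nu x = lev p n) : Even n := by
  have h0 := hram.ne_zero_of_nu hn
  obtain ⟨a, rfl⟩ := hram.exists_of_conj_eq hx
  have ha : a ≠ 0 := by
    rintro rfl
    simp at h0
  obtain ⟨m, hm⟩ := norm_sq_eq_lev ha
  rw [hram.nu_algebraMap, hm, lev_inj] at hn
  exact ⟨m, by omega⟩

theorem nu_lt_iff
    (hram : IsRamifiedQuadratic p H conj ϖ)
    {x : H} {n : ℤ} : hram.nu x < lev p n ↔ hram.nu x ≤ lev p (n + 1) := by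
  by_cases hx : x = 0
  · simp [hx, hram.nu_zero, lev_pos, (lev_pos p _).le]
  · obtain ⟨m, hm⟩ := hram.exists_lev hx
    rw [hm, lev_lt_iff, lev_le_iff]
    omega

theorem nu_two
    (hram : IsRamifiedQuadratic p H conj ϖ) (hp : p ≠ 2) : hram.nu 2 = 1 := by
  have h := hram.nu_algebraMap 2
  have h2 : ‖(2 : ℚ_[p])‖ = 1 := by
    have : ‖((2 : ℕ) : ℚ_[p])‖ = 1 := by
      rw [Padic.norm_natCast_eq_one_iff]
      rw [Nat.coprime_primes Fact.out Nat.prime_two]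
      exact hp
    simpa using this
  rw [h2, map_ofNat, one_pow] at h
  exact h

/-- The trace of an element of even valuation has the same valuation. -/
theorem nu_add_conj
    (hram : IsRamifiedQuadratic p H conj ϖ)
    (hp : p ≠ 2) {x : H} {n : ℤ} (hn : Even n) (hx : hram.nu x = lev p n) :
    hram.nu (x + conj x) = lev p n := by
  have := hram.charZero
  obtain ⟨a, b, rfl⟩ := hram.exists_coords x
  have h : algebraMap ℚ_[p] H a + algebraMap ℚ_[p] H b * ϖ +
      conj (algebraMap ℚ_[p] H a + algebraMap ℚ_[p] H b * ϖ) = 2 * algebraMap ℚ_[p] H a := by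
    rw [map_add, map_mul, hram.conj_fix, hram.conj_fix, hram.conj_unif]
    ring
  rw [h, hram.nu_mul, hram.nu_two hp, one_mul, hram.nu_algebraMap]
  rw [hram.nu_coords] at hx
  rcases max_choice (‖a‖ ^ 2) (‖b‖ ^ 2 * lev p 1) with h1 | h1
  · rw [← hx, h1]
  · exfalso
    rw [h1] at hx
    have hb : b ≠ 0 := by
      rintro rfl
      simp at hx
      exact (lev_pos p n).ne hx
    obtain ⟨k, hk⟩ := norm_sq_eq_lev hb
    rw [hk, ← lev_add, lev_inj] at hx
    obtain ⟨m, rfl⟩ := hn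
    omega

end IsRamifiedQuadratic

end FieldTheory

end Ramified

namespace Ramified

section LocalSolvability

variable {p : ℕ} [Fact (Nat.Prime p)] {H : Type} [Field H] [Algebra ℚ_[p] H]
  {conj : H ≃+* H} {ϖ : H}

theorem norm_two_padicInt (hp : p ≠ 2) : ‖(2 : ℤ_[p])‖ = 1 := by
  have : ‖((2 : ℕ) : ℤ_[p])‖ = 1 := by
    rw [PadicInt.norm_natCast_eq_one_iff, Nat.coprime_primes Fact.out Nat.prime_two]
    exact hp
  simpa using this

theorem exists_sqrt_padicInt (hp : p ≠ 2) (D : ℤ_[p]) (hD : ‖D - 1‖ < 1) :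
    ∃ w : ℤ_[p], w * w = D ∧ ‖w - 1‖ < 1 := by
  have h2 : ‖(1 + 1 : ℤ_[p])‖ = 1 := by
    rw [one_add_one_eq_two]
    exact norm_two_padicInt hp
  obtain ⟨w, hw, hw1, -⟩ := hensels_lemma (p := p)
    (F := (Polynomial.X ^ 2 - Polynomial.C D : Polynomial ℤ_[p])) (a := 1) (by
      rw [← norm_neg] at hD
      simpa [h2] using hD)
  simp only [map_sub, map_pow, Polynomial.aeval_X, Polynomial.aeval_C, Algebra.algebraMap_self,
    RingHom.id_apply, Polynomial.derivative_X_pow, Polynomial.derivative_C, sub_zero] at hw hw1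
  norm_num [norm_two_padicInt hp] at hw1
  exact ⟨w, by linear_combination hw, hw1⟩

theorem exists_sq_add_sq_padicInt (hp : p ≠ 2) (b c : ℤ_[p]) (hb : ‖b‖ = 1) (hc : ‖c‖ = 1) :
    ∃ x y : ℤ_[p], b * (x * x) + c * (y * y) + 1 = 0 := by
  have lift : ∀ (b c : ℤ_[p]), ‖b‖ = 1 → ∀ x y : ℤ_[p], ‖x‖ = 1 →
      ‖b * (x * x) + c * (y * y) + 1‖ < 1 →
      ∃ x y : ℤ_[p], b * (x * x) + c * (y * y) + 1 = 0 := by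
    intro b c hb x y hx h
    obtain ⟨b', hb'⟩ : ∃ b', b * b' = 1 := (PadicInt.isUnit_iff.2 hb).exists_right_inv
    obtain ⟨x', hx'⟩ : ∃ x', x * x' = 1 := (PadicInt.isUnit_iff.2 hx).exists_right_inv
    obtain ⟨w, hw, -⟩ := exists_sqrt_padicInt hp (-(1 + c * (y * y)) * b' * x' * x') (by
      have h1 : -(1 + c * (y * y)) * b' * x' * x' - 1 =
          -((b * (x * x) + c * (y * y) + 1) * (b' * x' * x')) := by
        linear_combination (x * x' * x * x') * hb' + (x * x' + 1) * hx'
      rw [h1, norm_neg, norm_mul]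
      exact (mul_le_of_le_one_right (norm_nonneg _) (PadicInt.norm_le_one _)).trans_lt h)
    refine ⟨x * w, y, ?_⟩
    linear_combination (b * x * x) * hw - (1 + c * y * y) * (x * x' * x * x') * hb'
      - (1 + c * y * y) * (x * x' + 1) * hx'
  have hker : ∀ z : ℤ_[p], PadicInt.toZMod z = 0 ↔ ‖z‖ < 1 := by
    intro z
    rw [← RingHom.mem_ker, PadicInt.ker_toZMod, IsLocalRing.mem_maximalIdeal,
      PadicInt.mem_nonunits]
  have hnorm : ∀ z : ℤ_[p], ‖z‖ ≠ 1 → PadicInt.toZMod z = 0 := fun z hz =>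
    (hker z).2 (lt_of_le_of_ne (PadicInt.norm_le_one z) hz)
  have hunit : ∀ z : ℤ_[p], ‖z‖ = 1 → PadicInt.toZMod z ≠ 0 := fun z hz h0 =>
    ((hker z).1 h0).ne hz
  obtain ⟨x0, y0, h0⟩ := FiniteField.exists_root_sum_quadratic (R := ZMod p)
    (f := Polynomial.C (PadicInt.toZMod b) * Polynomial.X ^ 2 + Polynomial.C 0 * Polynomial.X
      + Polynomial.C 1)
    (g := Polynomial.C (PadicInt.toZMod c) * Polynomial.X ^ 2 + Polynomial.C 0 * Polynomial.X
      + Polynomial.C 0)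
    (Polynomial.degree_quadratic (hunit b hb)) (Polynomial.degree_quadratic (hunit c hc)) (by
      rw [ZMod.card]
      exact (Fact.out : p.Prime).mod_two_eq_one_iff_ne_two.2 hp)
  obtain ⟨x, rfl⟩ := ZMod.ringHom_surjective (PadicInt.toZMod (p := p)) x0
  obtain ⟨y, rfl⟩ := ZMod.ringHom_surjective (PadicInt.toZMod (p := p)) y0
  have h1 : PadicInt.toZMod (b * (x * x) + c * (y * y) + 1) = 0 := by
    simp only [map_add, map_mul, map_one]
    simp only [Polynomial.eval_add, Polynomial.eval_mul, Polynomial.eval_C, Polynomial.eval_pow,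
      Polynomial.eval_X] at h0
    linear_combination h0
  have h2 := (hker _).1 h1
  by_cases hx : ‖x‖ = 1
  · exact lift b c hb x y hx h2
  by_cases hy : ‖y‖ = 1
  · obtain ⟨y', x', h⟩ := lift c b hc y x hy (by rwa [add_comm (c * _)])
    exact ⟨x', y', by rw [← h]; ring⟩
  · rw [map_add, map_add, map_mul, map_mul, map_mul, map_mul, hnorm x hx, hnorm y hy] at h1
    simp at h1

namespace IsRamifiedQuadratic

theorem exists_padicInt_of_conj_eq (hram : IsRamifiedQuadratic p H conj ϖ) {x : H}
    (hx : conj x = x) (h1 : hram.nu x ≤ 1) :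
    ∃ a : ℤ_[p], x = algebraMap ℚ_[p] H (a : ℚ_[p]) := by
  obtain ⟨a, rfl⟩ := hram.exists_of_conj_eq hx
  rw [hram.nu_algebraMap] at h1
  exact ⟨⟨a, (sq_le_one_iff₀ (norm_nonneg _)).1 h1⟩, rfl⟩

theorem nu_algebraMap_padicInt (hram : IsRamifiedQuadratic p H conj ϖ) (a : ℤ_[p]) :
    hram.nu (algebraMap ℚ_[p] H (a : ℚ_[p])) = ‖a‖ ^ 2 := by
  rw [hram.nu_algebraMap, PadicInt.norm_def]

theorem exists_sqrt (hram : IsRamifiedQuadratic p H conj ϖ) (hp : p ≠ 2) {D : H}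
    (hD : conj D = D) (h1 : hram.nu (D - 1) < 1) :
    ∃ w : H, conj w = w ∧ w * w = D ∧ hram.nu (w - 1) < 1 := by
  obtain ⟨a, ha⟩ := hram.exists_padicInt_of_conj_eq (x := D - 1) (by simp [hD]) h1.le
  rw [ha, hram.nu_algebraMap_padicInt, sq_lt_one_iff₀ (norm_nonneg _)] at h1
  obtain ⟨w, hw, hw1⟩ := exists_sqrt_padicInt hp (1 + a) (by simpa using h1)
  refine ⟨algebraMap ℚ_[p] H w, hram.conj_fix _, ?_, ?_⟩
  · rw [← map_mul, ← PadicInt.coe_mul, hw, PadicInt.coe_add, PadicInt.coe_one, map_add, map_one,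
      ← ha, add_sub_cancel]
  · have h := hram.nu_algebraMap_padicInt (w - 1)
    rw [PadicInt.coe_sub, PadicInt.coe_one, map_sub, map_one] at h
    rw [h, sq_lt_one_iff₀ (norm_nonneg _)]
    exact hw1

/-- A diagonal ternary form with coefficients of equal valuation is isotropic. -/
theorem exists_isotropic_coeffs (hram : IsRamifiedQuadratic p H conj ϖ) (hp : p ≠ 2)
    {α β γ : H} (hα : conj α = α) (hβ : conj β = β) (hγ : conj γ = γ) {n : ℤ}
    (nα : hram.nu α = lev p n) (nβ : hram.nu β = lev p n) (nγ : hram.nu γ = lev p n) :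
    ∃ x y : H, conj x = x ∧ conj y = y ∧ hram.nu x ≤ 1 ∧ hram.nu y ≤ 1 ∧
      α * (x * x) + β * (y * y) + γ = 0 := by
  have hγ0 := hram.ne_zero_of_nu nγ
  have key : ∀ δ : H, conj δ = δ → hram.nu δ = lev p n →
      ∃ b : ℤ_[p], ‖b‖ = 1 ∧ δ / γ = algebraMap ℚ_[p] H (b : ℚ_[p]) := by
    intro δ hδ nδ
    have h1 : hram.nu (δ / γ) = 1 := by
      rw [div_eq_mul_inv, hram.nu_mul, hram.nu_inv, nδ, nγ, mul_inv_cancel₀ (lev_pos p n).ne']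
    obtain ⟨b, hb⟩ := hram.exists_padicInt_of_conj_eq (x := δ / γ) (by simp [hδ, hγ]) h1.le
    rw [hb, hram.nu_algebraMap_padicInt] at h1
    exact ⟨b, (pow_eq_one_iff_of_nonneg (norm_nonneg b) two_ne_zero).1 h1, hb⟩
  obtain ⟨b, hb, hb'⟩ := key α hα nα
  obtain ⟨c, hc, hc'⟩ := key β hβ nβ
  obtain ⟨x, y, h⟩ := exists_sq_add_sq_padicInt hp b c hb hc
  refine ⟨algebraMap ℚ_[p] H x, algebraMap ℚ_[p] H y, hram.conj_fix _, hram.conj_fix _, ?_, ?_, ?_⟩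
  · rw [hram.nu_algebraMap_padicInt, sq_le_one_iff₀ (norm_nonneg _)]
    exact PadicInt.norm_le_one _
  · rw [hram.nu_algebraMap_padicInt, sq_le_one_iff₀ (norm_nonneg _)]
    exact PadicInt.norm_le_one _
  · have h' := congrArg (fun z : ℤ_[p] => algebraMap ℚ_[p] H (z : ℚ_[p])) h
    simp only [PadicInt.coe_add, PadicInt.coe_mul, PadicInt.coe_one, PadicInt.coe_zero, map_add,
      map_mul, map_one, map_zero, ← hb', ← hc'] at h'
    field_simp at h'
    linear_combination h'

theorem mem_span_pi_iff (hram : IsRamifiedQuadratic p H conj ϖ) (x : OH p H) :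
    x ∈ Ideal.span {(⟨ϖ, hram.pi_mem⟩ : OH p H)} ↔ hram.nu (x : H) ≤ lev p 1 := by
  rw [Ideal.mem_span_singleton']
  constructor
  · rintro ⟨c, rfl⟩
    rw [Subring.coe_mul, hram.nu_mul, hram.nu_pi]
    exact mul_le_of_le_one_left (lev_pos p 1).le (hram.coe_le c)
  · intro h
    refine ⟨⟨(x : H) / ϖ, ?_⟩, Subtype.ext (div_mul_cancel₀ _ hram.pi_ne_zero)⟩
    rw [hram.mem_OH_iff, div_eq_mul_inv, hram.nu_mul, hram.nu_inv, hram.nu_pi,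
      mul_inv_le_iff₀ (lev_pos p 1), one_mul]
    exact h

theorem card_residue (hram : IsRamifiedQuadratic p H conj ϖ) :
    Nat.card (OH p H ⧸ Ideal.span {(⟨ϖ, hram.pi_mem⟩ : OH p H)}) = p := by
  let f : Fin p → OH p H ⧸ Ideal.span {(⟨ϖ, hram.pi_mem⟩ : OH p H)} := fun n =>
    Ideal.Quotient.mk _ ((n : ℕ) : OH p H)
  have hf : Function.Bijective f := by
    constructor
    · intro m n hmn
      have h1 := (hram.mem_span_pi_iff _).1 ((Ideal.Quotient.eq).1 hmn)
      have h2 : ((((m : ℕ) : OH p H) - ((n : ℕ) : OH p H) : OH p H) : H) =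
          algebraMap ℚ_[p] H ((((m : ℕ) : ℤ) - ((n : ℕ) : ℤ) : ℤ) : ℚ_[p]) := by
        push_cast
        simp
      rw [h2, hram.nu_algebraMap] at h1
      have h3 : ‖((((m : ℕ) : ℤ) - ((n : ℕ) : ℤ) : ℤ) : ℚ_[p])‖ < 1 := by
        rw [← sq_lt_one_iff₀ (norm_nonneg _)]
        refine h1.trans_lt ?_
        rw [← lev_zero p, lev_lt_iff]
        omega
      rw [Padic.norm_intCast_lt_one_iff] at h3
      have h4 : ((m : ℕ) : ZMod p) = ((n : ℕ) : ZMod p) := by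
        have := (ZMod.intCast_zmod_eq_zero_iff_dvd _ p).2 h3
        push_cast at this
        exact sub_eq_zero.1 this
      rw [ZMod.natCast_eq_natCast_iff', Nat.mod_eq_of_lt m.2, Nat.mod_eq_of_lt n.2] at h4
      exact Fin.ext h4
    · intro x
      obtain ⟨x, rfl⟩ := Ideal.Quotient.mk_surjective x
      obtain ⟨a, b, hab⟩ := hram.exists_coords (x : H)
      have hx := hram.coe_le x
      rw [hab, hram.nu_coords] at hx
      have ha : ‖a‖ ≤ 1 := (sq_le_one_iff₀ (norm_nonneg _)).1 ((le_max_left _ _).trans hx)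
      let z : ℤ_[p] := ⟨a, ha⟩
      refine ⟨⟨z.zmodRepr, z.zmodRepr_lt_p⟩, (Ideal.Quotient.eq).2 ?_⟩
      rw [← neg_mem_iff, neg_sub, hram.mem_span_pi_iff]
      have h1 : hram.nu ((x : H) - (z.zmodRepr : H)) < lev p 0 := by
        have h2 : (x : H) - (z.zmodRepr : H) =
            algebraMap ℚ_[p] H ((z - z.zmodRepr : ℤ_[p]) : ℚ_[p]) + algebraMap ℚ_[p] H b * ϖ := by
          rw [hab, PadicInt.coe_sub, PadicInt.coe_natCast, map_sub, map_natCast]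
          have hz : (z : ℚ_[p]) = a := rfl
          rw [hz]
          ring
        rw [h2, hram.nu_coords, lev_zero]
        apply max_lt
        · rw [sq_lt_one_iff₀ (norm_nonneg _)]
          exact z.norm_sub_zmodRepr_lt_one
        · by_cases hb0 : b = 0
          · simp [hb0]
          obtain ⟨k, hk⟩ := norm_sq_eq_lev hb0
          have hb2 := (le_max_right _ _).trans hx
          rw [hk, ← lev_add, ← lev_zero p] at hb2 ⊢
          rw [lev_le_iff] at hb2
          rw [lev_lt_iff]
          omega
      have h3 := hram.nu_lt_iff.1 h1
      push_cast
      simpa using h3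
  rw [← Nat.card_congr (Equiv.ofBijective f hf), Nat.card_fin]

end IsRamifiedQuadratic

end LocalSolvability

end Ramified

namespace Ramified

section Forms

variable {p : ℕ} [Fact (Nat.Prime p)] {H : Type} [Field H] [Algebra ℚ_[p] H]
  {conj : H ≃+* H} {ϖ : H} {C : Type} [AddCommGroup C] [Module H C]

namespace HermForm

theorem form_add_right (φ : HermForm H C conj) (x y z : C) :
    φ.form x (y + z) = φ.form x y + φ.form x z := by
  rw [φ.form_conj (y + z) x, φ.form_add, map_add, ← φ.form_conj, ← φ.form_conj]

theorem form_smul_right (φ : HermForm H C conj) (a : H) (x y : C) :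
    φ.form x (a • y) = conj a * φ.form x y := by
  rw [φ.form_conj (a • y) x, φ.form_smul, map_mul, ← φ.form_conj]

theorem form_zero_right (φ : HermForm H C conj) (x : C) : φ.form x 0 = 0 := by
  rw [φ.form_conj 0 x, φ.form_zero, map_zero]

theorem form_comm_zero (φ : HermForm H C conj) {x y : C} (h : φ.form x y = 0) :
    φ.form y x = 0 := by
  rw [φ.form_conj x y, h, map_zero]

theorem form_sum (φ : HermForm H C conj) {ι : Type*} (s : Finset ι) (f : ι → C) (y : C) :
    φ.form (∑ i ∈ s, f i) y = ∑ i ∈ s, φ.form (f i) y := by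
  induction s using Finset.induction_on with
  | empty => simp [φ.form_zero]
  | insert a s ha ih => rw [Finset.sum_insert ha, Finset.sum_insert ha, φ.form_add, ih]

theorem nu_form_comm (φ : HermForm H C conj) (hram : IsRamifiedQuadratic p H conj ϖ) (x y : C) :
    hram.nu (φ.form y x) = hram.nu (φ.form x y) := by
  rw [φ.form_conj x y, hram.nu_conj]

theorem nu_form_span_le (φ : HermForm H C conj) (hram : IsRamifiedQuadratic p H conj ϖ)
    {S T : Set C} {r : ℝ} (hr : 0 ≤ r)
    (h : ∀ x ∈ S, ∀ y ∈ T, hram.nu (φ.form x y) ≤ r) {x y : C}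
    (hx : x ∈ Submodule.span (OH p H) S) (hy : y ∈ Submodule.span (OH p H) T) :
    hram.nu (φ.form x y) ≤ r := by
  have hsm : ∀ (c : OH p H) (z : H), hram.nu z ≤ r → hram.nu ((c : H) * z) ≤ r := by
    intro c z hz
    rw [hram.nu_mul]
    exact (mul_le_of_le_one_left (hram.nu_nonneg _) (hram.coe_le c)).trans hz
  have h1 : ∀ y ∈ T, hram.nu (φ.form x y) ≤ r := by
    intro y hy
    induction hx using Submodule.span_induction with
    | mem x hx => exact h x hx y hy
    | zero => rwa [φ.form_zero, hram.nu_zero]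
    | add a b _ _ ha hb =>
      rw [φ.form_add]
      exact hram.nu_add_le_of_le ha hb
    | smul c a _ ha =>
      rw [oh_smul_def, φ.form_smul]
      exact hsm c _ ha
  induction hy using Submodule.span_induction with
  | mem y hy => exact h1 y hy
  | zero => rwa [φ.form_zero_right, hram.nu_zero]
  | add a b _ _ ha hb =>
    rw [φ.form_add_right]
    exact hram.nu_add_le_of_le ha hb
  | smul c a _ ha =>
    rw [oh_smul_def, φ.form_smul_right, hram.nu_mul, hram.nu_conj, ← hram.nu_mul]
    exact hsm c _ ha

theorem form_span_eq_zero (φ : HermForm H C conj) (hram : IsRamifiedQuadratic p H conj ϖ)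
    {S T : Set C} (h : ∀ x ∈ S, ∀ y ∈ T, φ.form x y = 0) {x y : C}
    (hx : x ∈ Submodule.span (OH p H) S) (hy : y ∈ Submodule.span (OH p H) T) :
    φ.form x y = 0 := by
  have h1 := φ.nu_form_span_le hram le_rfl (S := S) (T := T)
    (fun x hx y hy => by rw [h x hx y hy, hram.nu_zero]) hx hy
  by_contra h0
  obtain ⟨n, hn⟩ := hram.exists_lev h0
  exact absurd (hn ▸ h1) (lev_pos p n).not_ge

end HermForm

theorem smul_mem_of_nu_le (hram : IsRamifiedQuadratic p H conj ϖ) (M : Submodule (OH p H) C)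
    {a : H} (ha : hram.nu a ≤ 1) {x : C} (hx : x ∈ M) : a • x ∈ M :=
  M.smul_mem (⟨a, (hram.mem_OH_iff a).2 ha⟩ : OH p H) hx

theorem pi_zpow_smul_mem (hram : IsRamifiedQuadratic p H conj ϖ) (M : Submodule (OH p H) C)
    {n : ℤ} (hn : 0 ≤ n) {x : C} (hx : x ∈ M) : ϖ ^ n • x ∈ M := by
  apply smul_mem_of_nu_le hram M _ hx
  rw [hram.nu_pi_zpow, ← lev_zero p, lev_le_iff]
  exact hn

theorem span_span_OH (S : Set C) :
    Submodule.span H ((Submodule.span (OH p H) S : Submodule (OH p H) C) : Set C) =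
      Submodule.span H S := by
  apply le_antisymm
  · rw [Submodule.span_le]
    intro x hx
    induction hx using Submodule.span_induction with
    | mem x hx => exact Submodule.subset_span hx
    | zero => exact zero_mem _
    | add a b _ _ ha hb => exact add_mem ha hb
    | smul c a _ ha => exact Submodule.smul_mem _ (c : H) ha
  · exact Submodule.span_mono Submodule.subset_span

theorem mem_span_range_iff_nu (hram : IsRamifiedQuadratic p H conj ϖ) {ι : Type} [Fintype ι]
    {v : ι → C} {x : C} : x ∈ Submodule.span (OH p H) (Set.range v) ↔
      ∃ c : ι → H, (∀ i, hram.nu (c i) ≤ 1) ∧ x = ∑ i, c i • v i := by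
  rw [Submodule.mem_span_range_iff_exists_fun]
  constructor
  · rintro ⟨c, rfl⟩
    exact ⟨fun i => c i, fun i => hram.coe_le _, rfl⟩
  · rintro ⟨c, hc, rfl⟩
    exact ⟨fun i => ⟨c i, (hram.mem_OH_iff _).2 (hc i)⟩, rfl⟩

/-- A family of vectors whose Gram matrix is monomial with respect to an involution `σ`, the
nonzero entry in row `i` having valuation `d i`. -/
structure Mono (hram : IsRamifiedQuadratic p H conj ϖ) (φ : HermForm H C conj) {ι : Type}
    (v : ι → C) (σ : ι → ι) (d : ι → ℤ) : Prop where
  invol : ∀ i, σ (σ i) = i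
  orth : ∀ i j, j ≠ σ i → φ.form (v i) (v j) = 0
  val : ∀ i, hram.nu (φ.form (v i) (v (σ i))) = lev p (d i)

/-- A `π ^ n`-modular lattice, in a form suited to splitting off summands. -/
structure ModLat (hram : IsRamifiedQuadratic p H conj ϖ) (φ : HermForm H C conj) (n : ℤ)
    (M : Submodule (OH p H) C) : Prop where
  int : ∀ x ∈ M, ∀ y ∈ M, hram.nu (φ.form x y) ≤ lev p n
  div : ∀ x ∈ M, (∀ y ∈ M, hram.nu (φ.form x y) ≤ lev p (n + 1)) → ∃ y ∈ M, x = ϖ • y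
  nondeg : ∀ x ∈ M, (∀ y ∈ M, φ.form x y = 0) → x = 0

variable {hram : IsRamifiedQuadratic p H conj ϖ} {φ : HermForm H C conj}

namespace Mono

variable {ι : Type} {v : ι → C} {σ : ι → ι} {d : ι → ℤ}

theorem form_ne_zero (h : Mono hram φ v σ d) (i : ι) : φ.form (v i) (v (σ i)) ≠ 0 :=
  hram.ne_zero_of_nu (h.val i)

theorem d_sigma (h : Mono hram φ v σ d) (i : ι) : d (σ i) = d i := by
  have h1 := h.val (σ i)
  rw [h.invol, φ.nu_form_comm hram, h.val, lev_inj] at h1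
  exact h1.symm

theorem even_of_fixed (h : Mono hram φ v σ d) {i : ι} (hi : σ i = i) : Even (d i) := by
  have h1 := h.val i
  rw [hi] at h1
  exact hram.even_of_conj_eq (φ.form_conj _ _).symm h1

theorem orth' (h : Mono hram φ v σ d) {i j : ι} (hij : j ≠ i) :
    φ.form (v j) (v (σ i)) = 0 := by
  apply h.orth
  intro h1
  apply hij
  rw [← h.invol j, ← h1, h.invol]

theorem form_sum [Fintype ι] (h : Mono hram φ v σ d) (c : ι → H) (i : ι) :
    φ.form (∑ j, c j • v j) (v (σ i)) = c i * φ.form (v i) (v (σ i)) := by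
  rw [φ.form_sum, Finset.sum_eq_single i, φ.form_smul]
  · intro j _ hj
    rw [φ.form_smul, h.orth' hj, mul_zero]
  · simp

theorem linearIndependent [Fintype ι] (h : Mono hram φ v σ d) : LinearIndependent H v := by
  rw [Fintype.linearIndependent_iff]
  intro c hc i
  have h1 := h.form_sum c i
  rw [hc, φ.form_zero] at h1
  exact (mul_eq_zero.1 h1.symm).resolve_right (h.form_ne_zero i)

theorem finrank_span [Fintype ι] (h : Mono hram φ v σ d) :
    rk (Submodule.span (OH p H) (Set.range v)) = Fintype.card ι := by
  rw [rk, span_span_OH]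
  exact finrank_span_eq_card h.linearIndependent

theorem modLat [Fintype ι] {n : ℤ} (h : Mono hram φ v σ (fun _ => n)) :
    ModLat hram φ n (Submodule.span (OH p H) (Set.range v)) := by
  have hv : ∀ i, v i ∈ Submodule.span (OH p H) (Set.range v) := fun i =>
    Submodule.subset_span ⟨i, rfl⟩
  refine ⟨?_, ?_, ?_⟩
  · intro x hx y hy
    refine φ.nu_form_span_le hram (lev_pos p n).le ?_ hx hy
    rintro _ ⟨i, rfl⟩ _ ⟨j, rfl⟩
    by_cases hj : j = σ i
    · rw [hj, h.val]
    · rw [h.orth i j hj, hram.nu_zero]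
      exact (lev_pos p n).le
  · intro x hx hxy
    obtain ⟨c, hc, rfl⟩ := (mem_span_range_iff_nu hram).1 hx
    refine ⟨∑ i, (ϖ⁻¹ * c i) • v i,
      (mem_span_range_iff_nu hram).2 ⟨fun i => ϖ⁻¹ * c i, fun i => ?_, rfl⟩, ?_⟩
    · have h1 := hxy _ (hv (σ i))
      rw [h.form_sum, hram.nu_mul, h.val, add_comm, lev_add,
        mul_le_mul_iff_left₀ (lev_pos p n)] at h1
      rw [hram.nu_mul, hram.nu_inv, hram.nu_pi, inv_mul_le_iff₀ (lev_pos p 1), mul_one]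
      exact h1
    · rw [Finset.smul_sum]
      refine Finset.sum_congr rfl fun i _ => ?_
      rw [smul_smul, mul_inv_cancel_left₀ hram.pi_ne_zero]
  · intro x hx hxy
    obtain ⟨c, hc, rfl⟩ := (mem_span_range_iff_nu hram).1 hx
    refine Finset.sum_eq_zero fun i _ => ?_
    have h1 := hxy _ (hv (σ i))
    rw [h.form_sum] at h1
    rw [(mul_eq_zero.1 h1).resolve_right (h.form_ne_zero i), zero_smul]

theorem rescale (h : Mono hram φ v σ d) (a : ι → ℤ) :
    Mono hram φ (fun i => ϖ ^ a i • v i) σ (fun i => d i + a i + a (σ i)) := by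
  refine ⟨h.invol, ?_, ?_⟩
  · intro i j hj
    rw [φ.form_smul, φ.form_smul_right, h.orth i j hj, mul_zero, mul_zero]
  · intro i
    rw [φ.form_smul, φ.form_smul_right, hram.nu_mul, hram.nu_mul, hram.nu_conj, hram.nu_pi_zpow,
      hram.nu_pi_zpow, h.val, lev_add, lev_add]
    ring

theorem sum {ι' : Type} {v' : ι' → C} {σ' : ι' → ι'} {d' : ι' → ℤ} (h : Mono hram φ v σ d)
    (h' : Mono hram φ v' σ' d') (horth : ∀ i j, φ.form (v i) (v' j) = 0) :
    Mono hram φ (Sum.elim v v') (Sum.map σ σ') (Sum.elim d d') := by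
  refine ⟨?_, ?_, ?_⟩
  · rintro (i | i)
    · simp [h.invol]
    · simp [h'.invol]
  · rintro (i | i) (j | j) hj
    · exact h.orth i j fun e => hj (congrArg Sum.inl e)
    · exact horth i j
    · exact φ.form_comm_zero (horth j i)
    · exact h'.orth i j fun e => hj (congrArg Sum.inr e)
  · rintro (i | i)
    · exact h.val i
    · exact h'.val i

theorem sum_const {ι' : Type} {v' : ι' → C} {σ' : ι' → ι'} {n : ℤ}
    (h : Mono hram φ v σ (fun _ => n))
    (h' : Mono hram φ v' σ' (fun _ => n)) (horth : ∀ i j, φ.form (v i) (v' j) = 0) :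
    Mono hram φ (Sum.elim v v') (Sum.map σ σ') (fun _ => n) := by
  have h1 := h.sum h' horth
  have h2 : (Sum.elim (fun _ => n) (fun _ => n) : ι ⊕ ι' → ℤ) = fun _ => n := by
    ext (i | i) <;> rfl
  rwa [h2] at h1

theorem sigma {κ : Type} {ι : κ → Type} {v : ∀ k, ι k → C} {σ : ∀ k, ι k → ι k}
    {d : ∀ k, ι k → ℤ} (h : ∀ k, Mono hram φ (v k) (σ k) (d k))
    (horth : ∀ k l, k ≠ l → ∀ i j, φ.form (v k i) (v l j) = 0) :
    Mono hram φ (fun x : Σ k, ι k => v x.1 x.2) (fun x => ⟨x.1, σ x.1 x.2⟩)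
      (fun x => d x.1 x.2) := by
  refine ⟨?_, ?_, ?_⟩
  · rintro ⟨k, i⟩
    simp [(h k).invol]
  · rintro ⟨k, i⟩ ⟨l, j⟩ hj
    by_cases hkl : k = l
    · subst hkl
      exact (h k).orth i j fun e => hj (by simp [e])
    · exact horth k l hkl i j
  · rintro ⟨k, i⟩
    exact (h k).val i

end Mono

/-- The hyperbolic pair `e, f` as a family indexed by `Bool`. -/
def pairFam (e f : C) : Bool → C := fun b => cond b e f

theorem span_range_sum_elim {ι ι' : Type} (v : ι → C) (v' : ι' → C) :
    Submodule.span (OH p H) (Set.range (Sum.elim v v')) =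
      Submodule.span (OH p H) (Set.range v) ⊔ Submodule.span (OH p H) (Set.range v') := by
  rw [Set.Sum.elim_range, Submodule.span_union]

namespace ModLat

variable {n : ℤ} {M : Submodule (OH p H) C}

section Peel

variable {ι : Type} [Fintype ι] {w : ι → C} {σ : ι → ι}

theorem sup_orthog (h : ModLat hram φ n M) (hw : Mono hram φ w σ (fun _ => n))
    (hwM : ∀ i, w i ∈ M) :
    Submodule.span (OH p H) (Set.range w) ⊔
      (M ⊓ φ.orthog (Submodule.span (OH p H) (Set.range w))) = M := by
  apply le_antisymm
  · refine sup_le ?_ inf_le_left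
    rw [Submodule.span_le]
    rintro _ ⟨i, rfl⟩
    exact hwM i
  · intro x hx
    let c : ι → H := fun i => φ.form x (w (σ i)) / φ.form (w i) (w (σ i))
    have hc : ∀ i, hram.nu (c i) ≤ 1 := by
      intro i
      simp only [c]
      rw [div_eq_mul_inv, hram.nu_mul, hram.nu_inv, hw.val, mul_inv_le_iff₀ (lev_pos p n), one_mul]
      exact h.int x hx _ (hwM _)
    have hs : ∑ i, c i • w i ∈ Submodule.span (OH p H) (Set.range w) :=
      (mem_span_range_iff_nu hram).2 ⟨c, hc, rfl⟩
    have hsM : ∑ i, c i • w i ∈ M :=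
      sum_mem fun i _ => smul_mem_of_nu_le hram M (hc i) (hwM i)
    have hx' : x = ∑ i, c i • w i + (x - ∑ i, c i • w i) := by abel
    rw [hx']
    refine Submodule.add_mem_sup hs ⟨sub_mem hx hsM, ?_⟩
    intro y hy
    refine φ.form_span_eq_zero hram (S := {x - ∑ i, c i • w i}) ?_
      (Submodule.subset_span rfl) hy
    rintro _ rfl _ ⟨j, rfl⟩
    have h1 : φ.form (x - ∑ i, c i • w i) (w j) =
        φ.form x (w j) - φ.form (∑ i, c i • w i) (w j) := by
      rw [sub_eq_add_neg, ← neg_one_smul H, φ.form_add, φ.form_smul]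
      ring
    have h2 := hw.form_sum c (σ j)
    rw [hw.invol] at h2
    rw [h1, h2]
    have h3 := hw.form_ne_zero (σ j)
    rw [hw.invol] at h3
    simp only [c, hw.invol]
    rw [div_mul_cancel₀ _ h3, sub_self]

theorem orthog (h : ModLat hram φ n M) (hw : Mono hram φ w σ (fun _ => n))
    (hwM : ∀ i, w i ∈ M) :
    ModLat hram φ n (M ⊓ φ.orthog (Submodule.span (OH p H) (Set.range w))) := by
  have key : ∀ x ∈ φ.orthog (Submodule.span (OH p H) (Set.range w)), ∀ y ∈ M,
      ∃ y' ∈ M ⊓ φ.orthog (Submodule.span (OH p H) (Set.range w)),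
        φ.form x y = φ.form x y' := by
    intro x hx y hy
    rw [← h.sup_orthog hw hwM] at hy
    obtain ⟨s, hs, y', hy', rfl⟩ := Submodule.mem_sup.1 hy
    exact ⟨y', hy', by rw [φ.form_add_right, hx s hs, zero_add]⟩
  refine ⟨fun x hx y hy => h.int x hx.1 y hy.1, ?_, ?_⟩
  · rintro x ⟨hx, hx'⟩ hxy
    obtain ⟨y, hy, rfl⟩ := h.div x hx fun y hy => by
      obtain ⟨y', hy', e⟩ := key x hx' y hy
      rw [e]
      exact hxy y' hy'
    refine ⟨y, ⟨hy, fun z hz => ?_⟩, rfl⟩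
    have h1 := hx' z hz
    rw [φ.form_smul] at h1
    exact (mul_eq_zero.1 h1).resolve_left hram.pi_ne_zero
  · rintro x ⟨hx, hx'⟩ hxy
    refine h.nondeg x hx fun y hy => ?_
    obtain ⟨y', hy', e⟩ := key x hx' y hy
    rw [e]
    exact hxy y' hy'

end Peel

theorem rk_orthog_lt [FiniteDimensional H C] {ι : Type} [Nonempty ι] {w : ι → C} {σ : ι → ι}
    (hw : Mono hram φ w σ (fun _ => n)) (hwM : ∀ i, w i ∈ M) :
    rk (M ⊓ φ.orthog (Submodule.span (OH p H) (Set.range w))) < rk M := by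
  apply Submodule.finrank_lt_finrank_of_lt
  refine lt_of_le_of_ne (Submodule.span_mono inf_le_left) fun he => ?_
  obtain ⟨i⟩ := ‹Nonempty ι›
  have h1 : w i ∈ Submodule.span H (M : Set C) := Submodule.subset_span (hwM i)
  rw [← he] at h1
  refine hw.form_ne_zero i ?_
  have h2 : w (σ i) ∈ Submodule.span (OH p H) (Set.range w) := Submodule.subset_span ⟨_, rfl⟩
  generalize w i = x at h1
  induction h1 using Submodule.span_induction with
  | mem x hx => exact hx.2 _ h2
  | zero => exact φ.form_zero _
  | add a b _ _ ha hb => rw [φ.form_add, ha, hb, add_zero]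
  | smul c a _ ha => rw [φ.form_smul, ha, mul_zero]

theorem exists_form_eq (h : ModLat hram φ n M) (hM : M ≠ ⊥) :
    ∃ x ∈ M, ∃ y ∈ M, hram.nu (φ.form x y) = lev p n := by
  have hex : ∃ m : ℕ, ∃ x ∈ M, ∃ y ∈ M, hram.nu (φ.form x y) = lev p (n + m) := by
    obtain ⟨x, hx, hx0⟩ := Submodule.exists_mem_ne_zero_of_ne_bot hM
    have h1 : ∃ y ∈ M, φ.form x y ≠ 0 := by
      by_contra! hc
      exact hx0 (h.nondeg x hx hc)
    obtain ⟨y, hy, h0⟩ := h1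
    obtain ⟨k, hk⟩ := hram.exists_lev h0
    have h2 := h.int x hx y hy
    rw [hk, lev_le_iff] at h2
    refine ⟨(k - n).toNat, x, hx, y, hy, ?_⟩
    rw [hk, Int.toNat_of_nonneg (by omega), add_sub_cancel]
  obtain ⟨m, ⟨x, hx, y, hy, hxy⟩, hmin⟩ : ∃ m : ℕ, (∃ x ∈ M, ∃ y ∈ M,
      hram.nu (φ.form x y) = lev p (n + m)) ∧ ∀ m' < m, ¬ ∃ x ∈ M, ∃ y ∈ M,
      hram.nu (φ.form x y) = lev p (n + m') :=
    ⟨Nat.find hex, Nat.find_spec hex, fun _ h => Nat.find_min hex h⟩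
  rcases Nat.eq_zero_or_pos m with rfl | hm
  · exact ⟨x, hx, y, hy, by simpa using hxy⟩
  · exfalso
    obtain ⟨x', hx', rfl⟩ := h.div x hx fun y' hy' => by
      rw [← hram.nu_lt_iff]
      refine lt_of_le_of_ne (h.int x hx y' hy') fun he => ?_
      exact hmin 0 hm ⟨x, hx, y', hy', by simpa using he⟩
    refine hmin (m - 1) (by omega) ⟨x', hx', y, hy, ?_⟩
    rw [φ.form_smul, hram.nu_mul, hram.nu_pi] at hxy
    have h1 : n + (m : ℤ) = 1 + (n + ((m - 1 : ℕ) : ℤ)) := by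
      push_cast [hm]
      ring
    rw [h1, lev_add p 1] at hxy
    exact mul_left_cancel₀ (lev_pos p 1).ne' hxy

theorem exists_form_self_eq (h : ModLat hram φ n M) (hp : p ≠ 2) (hn : Even n) (hM : M ≠ ⊥) :
    ∃ x ∈ M, hram.nu (φ.form x x) = lev p n := by
  obtain ⟨x, hx, y, hy, hxy⟩ := h.exists_form_eq hM
  by_contra! hc
  have hlt : ∀ z ∈ M, hram.nu (φ.form z z) ≤ lev p (n + 1) := fun z hz =>
    hram.nu_lt_iff.1 (lt_of_le_of_ne (h.int z hz z hz) (hc z hz))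
  have h1 := hram.nu_add_conj hp hn hxy
  have h2 : φ.form x y + conj (φ.form x y) =
      φ.form (x + y) (x + y) + (-φ.form x x + -φ.form y y) := by
    rw [φ.form_add, φ.form_add_right, φ.form_add_right, φ.form_conj x y]
    ring
  have h3 : hram.nu (φ.form x y + conj (φ.form x y)) ≤ lev p (n + 1) := by
    rw [h2]
    refine hram.nu_add_le_of_le (hlt _ (add_mem hx hy)) (hram.nu_add_le_of_le ?_ ?_)
    · rw [hram.nu_neg]
      exact hlt x hx
    · rw [hram.nu_neg]
      exact hlt y hy
  rw [h1, lev_le_iff] at h3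
  omega

/-- A primitive isotropic vector of a modular lattice lies in a hyperbolic plane. -/
theorem exists_pair (h : ModLat hram φ n M) (hp : p ≠ 2) {e y : C} (he : e ∈ M) (hy : y ∈ M)
    (hee : φ.form e e = 0) (hey : hram.nu (φ.form e y) = lev p n) :
    ∃ f ∈ M, Mono hram φ (pairFam e f) not (fun _ => n) := by
  have := hram.charZero
  have h0 := hram.ne_zero_of_nu hey
  have h0' : conj (φ.form e y) ≠ 0 := by
    rwa [Ne, map_eq_zero_iff conj conj.injective]
  have hyy : conj (φ.form y y) = φ.form y y := (φ.form_conj y y).symm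
  let c : H := -φ.form y y / (2 * φ.form e y)
  have hc : hram.nu c ≤ 1 := by
    simp only [c]
    rw [div_eq_mul_inv, hram.nu_mul, hram.nu_inv, hram.nu_mul, hram.nu_two hp, one_mul, hey,
      hram.nu_neg, mul_inv_le_iff₀ (lev_pos p n), one_mul]
    exact h.int y hy y hy
  have hcc : conj c = -φ.form y y / (2 * conj (φ.form e y)) := by
    simp only [c, map_div₀, map_neg, map_mul, map_ofNat, hyy]
  have hef : φ.form e (y + c • e) = φ.form e y := by
    rw [φ.form_add_right, φ.form_smul_right, hee, mul_zero, add_zero]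
  have hff : φ.form (y + c • e) (y + c • e) = 0 := by
    rw [φ.form_add, φ.form_smul, hef, φ.form_add_right, φ.form_smul_right, hcc, φ.form_conj e y]
    simp only [c]
    field_simp
    ring
  refine ⟨y + c • e, add_mem hy (smul_mem_of_nu_le hram M hc he), ?_, ?_, ?_⟩
  · intro i
    simp
  · rintro (_ | _) (_ | _) hij
    · exact hff
    · exact absurd rfl hij
    · exact absurd rfl hij
    · exact hee
  · rintro (_ | _)
    · show hram.nu (φ.form (y + c • e) e) = _
      rw [φ.nu_form_comm hram, hef, hey]
    · show hram.nu (φ.form e (y + c • e)) = _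
      rw [hef, hey]

end ModLat

end Forms

end Ramified

namespace Ramified

section Structure

variable {p : ℕ} [Fact (Nat.Prime p)] {H : Type} [Field H] [Algebra ℚ_[p] H]
  {conj : H ≃+* H} {ϖ : H} {C : Type} [AddCommGroup C] [Module H C]
  {hram : IsRamifiedQuadratic p H conj ϖ} {φ : HermForm H C conj} {n : ℤ}
  {M : Submodule (OH p H) C}

namespace ModLat

theorem mono_sum (h : ModLat hram φ n M) {ι ι' : Type} [Fintype ι] {w : ι → C} {σ : ι → ι}
    {v : ι' → C} {σ' : ι' → ι'} (hw : Mono hram φ w σ (fun _ => n)) (hwM : ∀ i, w i ∈ M)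
    (hv : Mono hram φ v σ' (fun _ => n))
    (hspan : Submodule.span (OH p H) (Set.range v) =
      M ⊓ φ.orthog (Submodule.span (OH p H) (Set.range w))) :
    Mono hram φ (Sum.elim w v) (Sum.map σ σ') (fun _ => n) ∧
      Submodule.span (OH p H) (Set.range (Sum.elim w v)) = M := by
  refine ⟨hw.sum_const hv fun i j => φ.form_comm_zero ?_, ?_⟩
  · have h1 : v j ∈ Submodule.span (OH p H) (Set.range v) := Submodule.subset_span ⟨j, rfl⟩
    rw [hspan] at h1
    exact h1.2 _ (Submodule.subset_span ⟨i, rfl⟩)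
  · rw [span_range_sum_elim, hspan, h.sup_orthog hw hwM]

theorem mono_single (hram : IsRamifiedQuadratic p H conj ϖ) {x : C}
    (hx : hram.nu (φ.form x x) = lev p n) :
    Mono hram φ (fun _ : Unit => x) id (fun _ => n) :=
  ⟨fun _ => rfl, fun _ _ h => absurd rfl h, fun _ => hx⟩

theorem mono_empty (hram : IsRamifiedQuadratic p H conj ϖ) (φ : HermForm H C conj) (n : ℤ) :
    Mono hram φ (fun i : Empty => i.elim) id (fun _ => n) :=
  ⟨fun i => i.elim, fun i => i.elim, fun i => i.elim⟩

theorem span_range_empty :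
    Submodule.span (OH p H) (Set.range (fun i : Empty => (i.elim : C))) = ⊥ := by
  rw [Set.range_eq_empty, Submodule.span_empty]

theorem nu_form_self_le (h : ModLat hram φ n M) (hn : Odd n) {x : C} (hx : x ∈ M) :
    hram.nu (φ.form x x) ≤ lev p (n + 1) := by
  rw [← hram.nu_lt_iff]
  refine lt_of_le_of_ne (h.int x hx x hx) fun he => ?_
  exact (Int.not_even_iff_odd.2 hn) (hram.even_of_conj_eq (φ.form_conj x x).symm he)

theorem exists_isotropic_of_odd (h : ModLat hram φ n M) (hp : p ≠ 2) (hn : Odd n) (hM : M ≠ ⊥) :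
    ∃ e ∈ M, ∃ y ∈ M, φ.form e e = 0 ∧ hram.nu (φ.form e y) = lev p n := by
  have hπ := hram.pi_ne_zero
  obtain ⟨x₀, hx₀, y, hy, hx₀y⟩ := h.exists_form_eq hM
  have h0 := hram.ne_zero_of_nu hx₀y
  obtain ⟨x, hx, hxy⟩ : ∃ x ∈ M, φ.form x y = ϖ ^ n := by
    refine ⟨(ϖ ^ n / φ.form x₀ y) • x₀, smul_mem_of_nu_le hram M ?_ hx₀, ?_⟩
    · rw [div_eq_mul_inv, hram.nu_mul, hram.nu_inv, hx₀y, hram.nu_pi_zpow,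
        mul_inv_cancel₀ (lev_pos p n).ne']
    · rw [φ.form_smul, div_mul_cancel₀ _ h0]
  have hcn : conj (ϖ ^ n) = -ϖ ^ n := by
    rw [hram.conj_pi_zpow, hn.neg_one_zpow, neg_one_mul]
  have hyx : φ.form y x = -ϖ ^ n := by rw [φ.form_conj x y, hxy, hcn]
  have hcn1 : conj (ϖ ^ (n + 1)) = ϖ ^ (n + 1) := by
    rw [hram.conj_pi_zpow, hn.add_one.neg_one_zpow, one_mul]
  have hq : ∀ z ∈ M, ∃ a : H, conj a = a ∧ hram.nu a ≤ 1 ∧ φ.form z z = ϖ ^ (n + 1) * a := by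
    intro z hz
    refine ⟨φ.form z z / ϖ ^ (n + 1), ?_, ?_, ?_⟩
    · rw [map_div₀, hcn1, ← φ.form_conj]
    · rw [div_eq_mul_inv, hram.nu_mul, hram.nu_inv, hram.nu_pi_zpow,
        mul_inv_le_iff₀ (lev_pos p _), one_mul]
      exact h.nu_form_self_le hn hz
    · rw [mul_div_cancel₀ _ (zpow_ne_zero _ hπ)]
  obtain ⟨a, ha, na, hxx⟩ := hq x hx
  obtain ⟨b, hb, nb, hyy⟩ := hq y hy
  have hab : hram.nu (a * b) ≤ 1 := by
    rw [hram.nu_mul]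
    exact mul_le_one₀ na (hram.nu_nonneg _) nb
  obtain ⟨w, hw, hww, nw⟩ := hram.exists_sqrt hp (D := 1 + ϖ * ϖ * (a * b))
    (by rw [map_add, map_mul, map_mul, map_mul, map_one, hram.conj_unif, ha, hb, neg_mul_neg]) (by
      rw [add_sub_cancel_left, hram.nu_mul, hram.nu_mul, hram.nu_pi, ← lev_add]
      refine lt_of_le_of_lt (mul_le_of_le_one_right (lev_pos p _).le hab) ?_
      rw [← lev_zero p, lev_lt_iff]
      omega)
  have nw1 : 1 ≤ hram.nu (1 + w) := by
    by_contra! hlt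
    have h2 := hram.nu_add_le (1 + w) (-(w - 1))
    have h3 : 1 + w + -(w - 1) = 2 := by ring
    rw [h3, hram.nu_two hp, hram.nu_neg] at h2
    exact absurd h2 (max_lt hlt nw).not_ge
  have hw0 : 1 + w ≠ 0 := by
    intro h1
    rw [h1, hram.nu_zero] at nw1
    linarith
  obtain ⟨s, hs⟩ : ∃ s, s = a / (1 + w) := ⟨_, rfl⟩
  have hcs : conj s = s := by rw [hs, map_div₀, map_add, map_one, ha, hw]
  have ns : hram.nu s ≤ 1 := by
    rw [hs, div_eq_mul_inv, hram.nu_mul, hram.nu_inv]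
    exact mul_le_one₀ na (inv_nonneg.2 (hram.nu_nonneg _)) (inv_le_one_of_one_le₀ nw1)
  have hquad : a - 2 * s - ϖ * ϖ * (s * s) * b = 0 := by
    rw [hs]
    field_simp
    linear_combination a * hww
  have nπs : hram.nu (ϖ * s) ≤ lev p 1 := by
    rw [hram.nu_mul, hram.nu_pi]
    exact mul_le_of_le_one_right (lev_pos p _).le ns
  have heM : x + (ϖ * s) • y ∈ M := by
    refine add_mem hx (smul_mem_of_nu_le hram M (nπs.trans ?_) hy)
    rw [← lev_zero p, lev_le_iff]
    omega
  refine ⟨x + (ϖ * s) • y, heM, y, hy, ?_, ?_⟩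
  · rw [φ.form_add, φ.form_smul, φ.form_add_right, φ.form_add_right, φ.form_smul_right,
      φ.form_smul_right, map_mul, hram.conj_unif, hcs, hxy, hyx, hxx, hyy, zpow_add_one₀ hπ]
    linear_combination ϖ ^ n * ϖ * hquad
  · by_contra hne
    have h1 := hram.nu_lt_iff.1 (lt_of_le_of_ne (h.int _ heM y hy) hne)
    have h2 : hram.nu (-((ϖ * s) * φ.form y y)) ≤ lev p (n + 1) := by
      rw [hram.nu_neg, hram.nu_mul, add_comm, lev_add]
      exact mul_le_mul nπs (h.int y hy y hy) (hram.nu_nonneg _) (lev_pos p 1).le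
    have h3 := hram.nu_add_le_of_le h1 h2
    rw [φ.form_add, φ.form_smul, add_neg_cancel_right, hxy, hram.nu_pi_zpow, lev_le_iff] at h3
    omega

theorem ne_bot_of_rk_ne_zero (h : rk M ≠ 0) : M ≠ ⊥ := by
  rintro rfl
  apply h
  simp [rk]

theorem pairFam_mem {e f : C} (he : e ∈ M) (hf : f ∈ M) : ∀ b, pairFam e f b ∈ M := by
  rintro (_ | _)
  · exact hf
  · exact he

variable [FiniteDimensional H C]

/-- A `π ^ n`-modular lattice with `n` even is diagonalizable. -/
theorem exists_mono_of_even (hp : p ≠ 2) (hn : Even n) (h : ModLat hram φ n M) :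
    ∃ (ι : Type) (_ : Fintype ι) (v : ι → C), Mono hram φ v id (fun _ => n) ∧
      Submodule.span (OH p H) (Set.range v) = M := by
  induction hr : rk M using Nat.strong_induction_on generalizing M with
  | _ r ih =>
  subst hr
  by_cases hM : M = ⊥
  · exact ⟨Empty, inferInstance, _, mono_empty hram φ n, by rw [span_range_empty, hM]⟩
  obtain ⟨x, hx, hxx⟩ := h.exists_form_self_eq hp hn hM
  have hw := mono_single hram hxx
  obtain ⟨ι, _, v, hv, hspan⟩ := ih _ (rk_orthog_lt hw fun _ => hx) (h.orthog hw fun _ => hx) rfl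
  obtain ⟨h1, h2⟩ := h.mono_sum hw (fun _ => hx) hv hspan
  exact ⟨Unit ⊕ ι, inferInstance, _, by simpa using h1, h2⟩

/-- A `π ^ n`-modular lattice with `n` odd is an orthogonal sum of hyperbolic planes. -/
theorem exists_mono_of_odd (hp : p ≠ 2) (hn : Odd n) (h : ModLat hram φ n M) :
    ∃ (ι : Type) (_ : Fintype ι) (v : ι → C) (σ : ι → ι), Mono hram φ v σ (fun _ => n) ∧
      Submodule.span (OH p H) (Set.range v) = M := by
  induction hr : rk M using Nat.strong_induction_on generalizing M with
  | _ r ih =>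
  subst hr
  by_cases hM : M = ⊥
  · exact ⟨Empty, inferInstance, _, _, mono_empty hram φ n, by rw [span_range_empty, hM]⟩
  obtain ⟨e, he, y, hy, hee, hey⟩ := h.exists_isotropic_of_odd hp hn hM
  obtain ⟨f, hf, hw⟩ := h.exists_pair hp he hy hee hey
  have hwM := pairFam_mem he hf
  obtain ⟨ι, _, v, σ, hv, hspan⟩ := ih _ (rk_orthog_lt hw hwM) (h.orthog hw hwM) rfl
  obtain ⟨h1, h2⟩ := h.mono_sum hw hwM hv hspan
  exact ⟨Bool ⊕ ι, inferInstance, _, _, h1, h2⟩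

theorem exists_isotropic_of_even (hp : p ≠ 2) (hn : Even n) (h : ModLat hram φ n M)
    (h3 : 3 ≤ rk M) :
    ∃ e ∈ M, ∃ y ∈ M, φ.form e e = 0 ∧ hram.nu (φ.form e y) = lev p n := by
  obtain ⟨ι, _, v, hv, rfl⟩ := exists_mono_of_even hp hn h
  rw [hv.finrank_span] at h3
  have hvM : ∀ i, v i ∈ Submodule.span (OH p H) (Set.range v) := fun i =>
    Submodule.subset_span ⟨i, rfl⟩
  obtain ⟨i, j, k, hij, hik, hjk⟩ := Fintype.two_lt_card_iff.1 h3
  have horth : ∀ a b, a ≠ b → φ.form (v a) (v b) = 0 := fun a b hab => hv.orth a b hab.symm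
  obtain ⟨x, y, hx, hy, nx, ny, hxy⟩ := hram.exists_isotropic_coeffs hp
    (φ.form_conj (v i) (v i)).symm (φ.form_conj (v j) (v j)).symm (φ.form_conj (v k) (v k)).symm
    (hv.val i) (hv.val j) (hv.val k)
  refine ⟨x • v i + y • v j + v k, add_mem (add_mem (smul_mem_of_nu_le hram _ nx (hvM i))
    (smul_mem_of_nu_le hram _ ny (hvM j))) (hvM k), v k, hvM k, ?_, ?_⟩
  · simp only [φ.form_add, φ.form_add_right, φ.form_smul, φ.form_smul_right, horth i j hij,
      horth i k hik, horth j k hjk, horth j i hij.symm, horth k i hik.symm, horth k j hjk.symm,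
      hx, hy]
    linear_combination hxy
  · simp only [φ.form_add, φ.form_smul, horth i k hik, horth j k hjk]
    simpa using hv.val k

/-- The Witt decomposition of an even modular lattice, with anisotropic part of rank one or
two. -/
theorem exists_witt (hp : p ≠ 2) (hn : Even n) (h : ModLat hram φ n M) (hM : M ≠ ⊥) :
    ∃ (ι : Type) (_ : Fintype ι) (v : ι → C) (σ : ι → ι), Mono hram φ v σ (fun _ => n) ∧
      Submodule.span (OH p H) (Set.range v) = M ∧
      (Finset.univ.filter fun i => σ i = i).card = if Odd (rk M) then 1 else 2 := by
  induction hr : rk M using Nat.strong_induction_on generalizing M with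
  | _ r ih =>
  subst hr
  by_cases h3 : 3 ≤ rk M
  · obtain ⟨e, he, y, hy, hee, hey⟩ := exists_isotropic_of_even hp hn h h3
    obtain ⟨f, hf, hw⟩ := h.exists_pair hp he hy hee hey
    have hwM := pairFam_mem he hf
    set N := M ⊓ φ.orthog (Submodule.span (OH p H) (Set.range (pairFam e f))) with hN
    have hNrk : rk M = 2 + rk N := by
      obtain ⟨ι, _, v, hv, hspan⟩ := exists_mono_of_even hp hn (h.orthog hw hwM)
      obtain ⟨h1, h2⟩ := h.mono_sum hw hwM hv hspan
      rw [hN, ← hspan, hv.finrank_span]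
      conv_lhs => rw [← h2]
      rw [h1.finrank_span]
      simp
    obtain ⟨ι, _, v, σ, hv, hspan, hcard⟩ := ih _ (rk_orthog_lt hw hwM) (h.orthog hw hwM)
      (ne_bot_of_rk_ne_zero (by rw [← hN]; omega)) rfl
    obtain ⟨h1, h2⟩ := h.mono_sum hw hwM hv hspan
    refine ⟨Bool ⊕ ι, inferInstance, _, _, h1, h2, ?_⟩
    have h4 : Odd (rk M) ↔ Odd (rk N) := by
      rw [hNrk, Nat.odd_iff, Nat.odd_iff]
      omega
    have h5 : (Finset.univ.filter fun i : Bool ⊕ ι => Sum.map not σ i = i) =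
        (Finset.univ.filter fun i => σ i = i).map Function.Embedding.inr := by
      ext (b | i)
      · simp
      · simp
    rw [if_congr h4 rfl rfl]
    rw [← hN] at hcard
    rw [← hcard]
    refine Eq.trans ?_ (Finset.card_map (Function.Embedding.inr : ι ↪ Bool ⊕ ι))
    rw [← h5]
    congr
  · obtain ⟨ι, _, v, hv, hspan⟩ := exists_mono_of_even hp hn h
    refine ⟨ι, inferInstance, v, id, hv, hspan, ?_⟩
    have h1 : rk M = Fintype.card ι := by rw [← hspan, hv.finrank_span]
    have h2 : rk M ≠ 0 := by
      intro h0
      apply hM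
      rw [h1, Fintype.card_eq_zero_iff] at h0
      rw [← hspan, Set.range_eq_empty, Submodule.span_empty]
    simp only [id, Finset.filter_true, Finset.card_univ, ← h1]
    have h4 : rk M = 1 ∨ rk M = 2 := by omega
    rcases h4 with h4 | h4
    · simp [h4]
    · simp [h4]

end ModLat

end Structure

end Ramified

namespace Ramified

section Vertex

variable {p : ℕ} [Fact (Nat.Prime p)] {H : Type} [Field H] [Algebra ℚ_[p] H]
  {conj : H ≃+* H} {ϖ : H} {C : Type} [AddCommGroup C] [Module H C]

/-- The vectors whose pairing with each `v i` has valuation at least `m i`. -/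
def latOf (hram : IsRamifiedQuadratic p H conj ϖ) (φ : HermForm H C conj) {ι : Type} (v : ι → C)
    (m : ι → ℤ) : Submodule (OH p H) C where
  carrier := {x | ∀ i, hram.nu (φ.form x (v i)) ≤ lev p (m i)}
  add_mem' := by
    intro x y hx hy i
    rw [φ.form_add]
    exact hram.nu_add_le_of_le (hx i) (hy i)
  zero_mem' := by
    intro i
    rw [φ.form_zero, hram.nu_zero]
    exact (lev_pos p _).le
  smul_mem' := by
    intro c x hx i
    rw [oh_smul_def, φ.form_smul, hram.nu_mul]
    exact (mul_le_of_le_one_left (hram.nu_nonneg _) (hram.coe_le c)).trans (hx i)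

variable {hram : IsRamifiedQuadratic p H conj ϖ} {φ : HermForm H C conj}

theorem mem_dual_span_iff (hram : IsRamifiedQuadratic p H conj ϖ) {S : Set C} {x : C} :
    x ∈ φ.dual (Submodule.span (OH p H) S) ↔ ∀ s ∈ S, hram.nu (φ.form x s) ≤ 1 := by
  constructor
  · intro h s hs
    exact (hram.mem_OH_iff _).1 (h s (Submodule.subset_span hs))
  · intro h y hy
    refine (hram.mem_OH_iff _).2 (φ.nu_form_span_le hram zero_le_one (S := {x}) ?_
      (Submodule.subset_span rfl) hy)
    rintro _ rfl
    exact h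

namespace Mono

variable {ι : Type} [Fintype ι] {v : ι → C} {σ : ι → ι} {d : ι → ℤ}

theorem form_sum' (h : Mono hram φ v σ d) (c : ι → H) (i : ι) :
    φ.form (∑ j, c j • v j) (v i) = c (σ i) * φ.form (v (σ i)) (v i) := by
  have h1 := h.form_sum c (σ i)
  rwa [h.invol] at h1

theorem exists_form_eq (h : Mono hram φ v σ d) (c : ι → H) :
    ∃ x, ∀ i, φ.form x (v i) = c i := by
  refine ⟨∑ j, (c (σ j) / φ.form (v j) (v (σ j))) • v j, fun i => ?_⟩
  have h1 := h.form_ne_zero (σ i)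
  rw [h.form_sum', h.invol]
  rw [h.invol] at h1
  exact div_mul_cancel₀ _ h1

theorem latOf_injective (h : Mono hram φ v σ d) {m m' : ι → ℤ}
    (hm : latOf hram φ v m = latOf hram φ v m') : m = m' := by
  have key : ∀ m m' : ι → ℤ, latOf hram φ v m ≤ latOf hram φ v m' → ∀ i, m' i ≤ m i := by
    intro m m' hle i
    obtain ⟨x, hx⟩ := h.exists_form_eq fun i => ϖ ^ m i
    have h1 : x ∈ latOf hram φ v m := fun i => by rw [hx, hram.nu_pi_zpow]
    have h2 := hle h1 i
    rwa [hx, hram.nu_pi_zpow, lev_le_iff] at h2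
  ext i
  exact le_antisymm (key m' m hm.ge i) (key m m' hm.le i)

theorem latOf_eq_span (h : Mono hram φ v σ d) (htop : Submodule.span H (Set.range v) = ⊤)
    (m : ι → ℤ) :
    latOf hram φ v m =
      Submodule.span (OH p H) (Set.range fun j => ϖ ^ (m (σ j) - d j) • v j) := by
  apply le_antisymm
  · intro x hx
    obtain ⟨c, rfl⟩ := (Submodule.mem_span_range_iff_exists_fun H).1
      (htop ▸ Submodule.mem_top : x ∈ Submodule.span H (Set.range v))
    refine (mem_span_range_iff_nu hram).2 ⟨fun j => c j * ϖ ^ (-(m (σ j) - d j)), fun j => ?_, ?_⟩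
    · have h1 := hx (σ j)
      have h2 : m (σ j) = (m (σ j) - d j) + d j := by ring
      rw [h.form_sum, hram.nu_mul, h.val, h2, lev_add, mul_le_mul_iff_left₀ (lev_pos p _)] at h1
      rw [hram.nu_mul, hram.nu_pi_zpow, ← lev_zero p, ← add_neg_cancel (m (σ j) - d j), lev_add]
      exact mul_le_mul_of_nonneg_right h1 (lev_pos p _).le
    · refine Finset.sum_congr rfl fun j _ => ?_
      rw [smul_smul, mul_assoc, ← zpow_add₀ hram.pi_ne_zero, neg_add_cancel, zpow_zero, mul_one]
  · rw [Submodule.span_le]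
    rintro _ ⟨j, rfl⟩ i
    rw [φ.form_smul]
    by_cases hij : i = σ j
    · rw [hij, hram.nu_mul, hram.nu_pi_zpow, h.val, ← lev_add, sub_add_cancel]
    · rw [h.orth j i hij, mul_zero, hram.nu_zero]
      exact (lev_pos p _).le

theorem isLattice_latOf (h : Mono hram φ v σ d) (htop : Submodule.span H (Set.range v) = ⊤)
    (m : ι → ℤ) :
    IsLattice (latOf hram φ v m) := by
  rw [h.latOf_eq_span htop]
  refine ⟨Submodule.fg_span (Set.finite_range _), ?_⟩
  rw [span_span_OH, eq_top_iff, ← htop, Submodule.span_le]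
  rintro _ ⟨j, rfl⟩
  have h1 : v j = ϖ ^ (-(m (σ j) - d j)) • ϖ ^ (m (σ j) - d j) • v j := by
    rw [smul_smul, ← zpow_add₀ hram.pi_ne_zero, neg_add_cancel, zpow_zero, one_smul]
  rw [h1]
  exact Submodule.smul_mem _ _ (Submodule.subset_span ⟨j, rfl⟩)

theorem dual_latOf (h : Mono hram φ v σ d) (htop : Submodule.span H (Set.range v) = ⊤)
    (m : ι → ℤ) :
    φ.dual (latOf hram φ v m) = latOf hram φ v fun i => d i - m (σ i) := by
  ext x
  rw [h.latOf_eq_span htop, mem_dual_span_iff hram, Set.forall_mem_range]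
  refine forall_congr' fun j => ?_
  have h1 : lev p (d j - m (σ j)) * lev p (m (σ j) - d j) = 1 := by
    rw [← lev_add, ← lev_zero p]
    congr 1
    ring
  rw [φ.form_smul_right, hram.nu_mul, hram.nu_conj, hram.nu_pi_zpow, mul_comm, ← h1,
    mul_le_mul_iff_left₀ (lev_pos p _)]

variable {L : Submodule (OH p H) C} {a : ι → ℤ} {S : Finset ι}

theorem inVert_latOf (h : Mono hram φ v σ d) (htop : Submodule.span H (Set.range v) = ⊤)
    (hL : L ≤ Submodule.span (OH p H) (Set.range v))
    (ha : ∀ i, a i + a (σ i) = d i + if i ∈ S then 1 else 0) (had : ∀ i, a i ≤ d i) :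
    φ.dual (latOf hram φ v fun i => a i - if i ∈ S then 1 else 0) = latOf hram φ v a ∧
      InVert φ ϖ L (latOf hram φ v fun i => a i - if i ∈ S then 1 else 0) := by
  have hdual : φ.dual (latOf hram φ v fun i => a i - if i ∈ S then 1 else 0) =
      latOf hram φ v a := by
    rw [h.dual_latOf htop]
    congr 1
    ext i
    have h1 := ha (σ i)
    rw [h.invol, h.d_sigma] at h1
    omega
  refine ⟨hdual, ⟨h.isLattice_latOf htop _, ?_, ?_⟩, ?_⟩
  · rw [hdual]
    rintro _ ⟨x, hx, rfl⟩ i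
    show hram.nu (φ.form (ϖ • x) (v i)) ≤ _
    rw [φ.form_smul, hram.nu_mul, hram.nu_pi]
    refine (mul_le_mul_of_nonneg_left (hx i) (lev_pos p 1).le).trans ?_
    rw [← lev_add, lev_le_iff]
    dsimp only
    split_ifs <;> omega
  · rw [hdual]
    intro x hx i
    refine (hx i).trans ?_
    rw [lev_le_iff]
    dsimp only
    split_ifs <;> omega
  · rw [hdual]
    refine hL.trans ?_
    rw [Submodule.span_le]
    rintro _ ⟨j, rfl⟩ i
    by_cases hij : i = σ j
    · rw [hij, h.val, lev_le_iff, ← h.d_sigma]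
      exact had _
    · rw [h.orth j i hij, hram.nu_zero]
      exact (lev_pos p _).le

theorem quotCard_latOf (h : Mono hram φ v σ d) :
    quotCard (latOf hram φ v a) (latOf hram φ v fun i => a i - if i ∈ S then 1 else 0) =
      p ^ S.card := by
  set Λ := latOf hram φ v fun i => a i - if i ∈ S then 1 else 0 with hΛ
  let I : Ideal (OH p H) := Ideal.span {⟨ϖ, hram.pi_mem⟩}
  have hmul : ∀ (z : H) (i : ι), hram.nu (z * ϖ ^ (1 - a i)) =
      hram.nu z * lev p (1 - a i) := fun z i => by rw [hram.nu_mul, hram.nu_pi_zpow]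
  have hmem : ∀ (x : Λ) (i : S), φ.form x (v i) * ϖ ^ (1 - a i) ∈ OH p H := by
    intro x i
    rw [hram.mem_OH_iff, hmul]
    have h1 := x.2 i
    dsimp only at h1
    rw [if_pos i.2] at h1
    refine (mul_le_mul_of_nonneg_right h1 (lev_pos p _).le).trans ?_
    rw [← lev_add, ← lev_zero p, lev_le_iff]
    omega
  let F : Λ →ₗ[OH p H] (S → OH p H ⧸ I) := {
    toFun := fun x i => Submodule.Quotient.mk ⟨_, hmem x i⟩
    map_add' := by
      intro x y
      ext i
      rw [Pi.add_apply, ← Submodule.Quotient.mk_add]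
      congr 1
      apply Subtype.ext
      show φ.form ((x : C) + y) (v i) * _ = _
      rw [φ.form_add, add_mul]
      rfl
    map_smul' := by
      intro c x
      ext i
      rw [Pi.smul_apply, RingHom.id_apply, ← Submodule.Quotient.mk_smul]
      congr 1
      apply Subtype.ext
      show φ.form ((c : H) • (x : C)) (v i) * _ = (c : H) * _
      rw [φ.form_smul, mul_assoc] }
  have hker : (latOf hram φ v a).comap Λ.subtype = LinearMap.ker F := by
    ext x
    rw [LinearMap.mem_ker, funext_iff]
    have h2 : ∀ i : S, F x i = 0 ↔ hram.nu (φ.form x (v i)) ≤ lev p (a i) := by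
      intro i
      show Submodule.Quotient.mk (p := I) _ = 0 ↔ _
      rw [Submodule.Quotient.mk_eq_zero, hram.mem_span_pi_iff, hmul]
      have h3 : lev p 1 = lev p (a i) * lev p (1 - a i) := by
        rw [← lev_add]
        congr 1
        ring
      rw [h3, mul_le_mul_iff_left₀ (lev_pos p _)]
    constructor
    · intro hx i
      exact (h2 i).2 (hx i)
    · intro hx i
      by_cases hi : i ∈ S
      · exact (h2 ⟨i, hi⟩).1 (hx ⟨i, hi⟩)
      · have h1 := x.2 i
        dsimp only at h1
        rwa [if_neg hi, sub_zero] at h1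
  have hsurj : Function.Surjective F := by
    intro r
    choose c hc using fun i => Submodule.Quotient.mk_surjective I (r i)
    obtain ⟨x, hx⟩ := h.exists_form_eq fun i =>
      if hi : i ∈ S then (c ⟨i, hi⟩ : H) * ϖ ^ (a i - 1) else 0
    have hxΛ : x ∈ Λ := by
      intro i
      rw [hx]
      by_cases hi : i ∈ S
      · dsimp only
        rw [dif_pos hi, if_pos hi, hram.nu_mul, hram.nu_pi_zpow]
        exact mul_le_of_le_one_left (lev_pos p _).le (hram.coe_le _)
      · rw [dif_neg hi, hram.nu_zero]
        exact (lev_pos p _).le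
    refine ⟨⟨x, hxΛ⟩, ?_⟩
    ext i
    rw [← hc i]
    show Submodule.Quotient.mk _ = _
    congr 1
    apply Subtype.ext
    show φ.form x (v i) * _ = _
    rw [hx, dif_pos i.2, mul_assoc, ← zpow_add₀ hram.pi_ne_zero]
    simp
  rw [quotCard, hker, Nat.card_congr (F.quotKerEquivOfSurjective hsurj).toEquiv, Nat.card_fun,
    hram.card_residue]
  simp

/-- The lattice in the span of a monomial family has two vertex lattices over it once the family
contains an off-diagonal pair of valuation at least two. -/
theorem exists_two_vert (h : Mono hram φ v σ d) (htop : Submodule.span H (Set.range v) = ⊤)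
    (hd : ∀ i, 0 ≤ d i)
    (hL : L ≤ Submodule.span (OH p H) (Set.range v)) (h2 : ∃ i, σ i ≠ i ∧ 2 ≤ d i) :
    ∃ Λ1 Λ2 : Submodule (OH p H) C, Λ1 ≠ Λ2 ∧ InVert φ ϖ L Λ1 ∧ InVert φ ϖ L Λ2 ∧
      quotCard (φ.dual Λ1) Λ1 = p ^ (Finset.univ.filter fun i => σ i ≠ i ∧ 1 ≤ d i).card ∧
      quotCard (φ.dual Λ2) Λ2 = p ^ (Finset.univ.filter fun i => σ i ≠ i ∧ 1 ≤ d i).card := by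
  set S := Finset.univ.filter fun i => σ i ≠ i ∧ 1 ≤ d i with hS
  have hmemS : ∀ i, i ∈ S ↔ σ i ≠ i ∧ 1 ≤ d i := fun i => by simp [hS]
  let e := Fintype.equivFin ι
  let a : ι → ℤ := fun i => if i ∈ S then (if e i < e (σ i) then d i else 1) else d i / 2
  let a' : ι → ℤ := fun i => if i ∈ S then (if e i < e (σ i) then 1 else d i) else d i / 2
  have hσS : ∀ i, σ i ∈ S ↔ i ∈ S := by
    intro i
    rw [hmemS, hmemS, h.invol, h.d_sigma, ne_comm]
  have heven : ∀ i, i ∉ S → d i / 2 + d i / 2 = d i := by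
    intro i hi
    have h1 : Even (d i) := by
      by_cases hσ : σ i = i
      · exact h.even_of_fixed hσ
      · have h0 : d i = 0 := by
          rw [hmemS, not_and, not_le] at hi
          have := hi hσ
          have := hd i
          omega
        simp [h0]
    obtain ⟨r, hr⟩ := h1
    omega
  have hlt : ∀ i, i ∈ S → (e (σ i) < e i ↔ ¬ e i < e (σ i)) := by
    intro i hi
    have hne : e (σ i) ≠ e i := fun hh => ((hmemS i).1 hi).1 (e.injective hh)
    rw [not_lt]
    exact ⟨le_of_lt, fun hle => lt_of_le_of_ne hle hne⟩
  have ha : ∀ i, a i + a (σ i) = d i + if i ∈ S then 1 else 0 := by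
    intro i
    by_cases hi : i ∈ S
    · simp only [a, hσS, hi, if_true, h.invol, hlt i hi, h.d_sigma]
      split_ifs <;> ring
    · simp only [a, hσS, hi, if_false, h.d_sigma]
      rw [heven i hi, add_zero]
  have ha' : ∀ i, a' i + a' (σ i) = d i + if i ∈ S then 1 else 0 := by
    intro i
    by_cases hi : i ∈ S
    · simp only [a', hσS, hi, if_true, h.invol, hlt i hi, h.d_sigma]
      split_ifs <;> ring
    · simp only [a', hσS, hi, if_false, h.d_sigma]
      rw [heven i hi, add_zero]
  have had : ∀ i, a i ≤ d i := by
    intro i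
    have h0 := hd i
    by_cases hi : i ∈ S
    · have h1 := ((hmemS i).1 hi).2
      simp only [a, hi, if_true]
      split_ifs <;> omega
    · simp only [a, hi, if_false]
      omega
  have had' : ∀ i, a' i ≤ d i := by
    intro i
    have h0 := hd i
    by_cases hi : i ∈ S
    · have h1 := ((hmemS i).1 hi).2
      simp only [a', hi, if_true]
      split_ifs <;> omega
    · simp only [a', hi, if_false]
      omega
  obtain ⟨hdual, hV⟩ := h.inVert_latOf htop hL ha had
  obtain ⟨hdual', hV'⟩ := h.inVert_latOf htop hL ha' had'
  refine ⟨_, _, ?_, hV, hV', ?_, ?_⟩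
  · intro heq
    obtain ⟨i, hi, h2i⟩ := h2
    have h1 := congrFun (h.latOf_injective heq) i
    have hiS : i ∈ S := (hmemS i).2 ⟨hi, by omega⟩
    simp only [a, a', hiS, if_true] at h1
    split_ifs at h1 <;> omega
  · rw [hdual, h.quotCard_latOf]
  · rw [hdual', h.quotCard_latOf]

end Mono

end Vertex

end Ramified

namespace Ramified

section Split

variable {p : ℕ} [Fact (Nat.Prime p)] {H : Type} [Field H] [Algebra ℚ_[p] H]
  {conj : H ≃+* H} {ϖ : H} {C : Type} [AddCommGroup C] [Module H C]
  {φ : HermForm H C conj}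

theorem isSplitLat_of_fintype {κ : Type} [Fintype κ] {N : Submodule (OH p H) C} (e f : κ → C)
    (d : κ → ℕ) (hN : N = Submodule.span (OH p H) (Set.range e ∪ Set.range f))
    (h : ∀ j, φ.form (e j) (e j) = 0 ∧ φ.form (f j) (f j) = 0 ∧ φ.form (e j) (f j) = ϖ ^ d j)
    (h' : ∀ j j', j ≠ j' → φ.form (e j) (e j') = 0 ∧ φ.form (e j) (f j') = 0 ∧
      φ.form (f j) (e j') = 0 ∧ φ.form (f j) (f j') = 0) :
    IsSplitLat φ ϖ N := by
  let g := (Fintype.equivFin κ).symm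
  refine ⟨Fintype.card κ, e ∘ g, f ∘ g, d ∘ g, ?_, fun j => h (g j), fun j j' hj => ?_⟩
  · rw [EquivLike.range_comp, EquivLike.range_comp, hN]
  · exact h' _ _ fun he => hj (g.injective he)

theorem IsSplitLat.bot : IsSplitLat φ ϖ (⊥ : Submodule (OH p H) C) := by
  refine isSplitLat_of_fintype (κ := Empty) (fun i => i.elim) (fun i => i.elim) (fun i => i.elim)
    ?_ (fun i => i.elim) (fun i => i.elim)
  rw [Set.range_eq_empty, Set.union_empty, Submodule.span_empty]

theorem IsSplitLat.sup {N N' : Submodule (OH p H) C} (h : IsSplitLat φ ϖ N)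
    (h' : IsSplitLat φ ϖ N') (horth : N ≤ φ.orthog N') : IsSplitLat φ ϖ (N ⊔ N') := by
  obtain ⟨s, e, f, d, rfl, h1, h2⟩ := h
  obtain ⟨s', e', f', d', rfl, h1', h2'⟩ := h'
  have he : ∀ j, e j ∈ Submodule.span (OH p H) (Set.range e ∪ Set.range f) := fun j =>
    Submodule.subset_span (Or.inl ⟨j, rfl⟩)
  have hf : ∀ j, f j ∈ Submodule.span (OH p H) (Set.range e ∪ Set.range f) := fun j =>
    Submodule.subset_span (Or.inr ⟨j, rfl⟩)
  have he' : ∀ j, e' j ∈ Submodule.span (OH p H) (Set.range e' ∪ Set.range f') := fun j =>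
    Submodule.subset_span (Or.inl ⟨j, rfl⟩)
  have hf' : ∀ j, f' j ∈ Submodule.span (OH p H) (Set.range e' ∪ Set.range f') := fun j =>
    Submodule.subset_span (Or.inr ⟨j, rfl⟩)
  refine isSplitLat_of_fintype (Sum.elim e e') (Sum.elim f f') (Sum.elim d d') ?_ ?_ ?_
  · rw [← Submodule.span_union, Set.Sum.elim_range, Set.Sum.elim_range, Set.union_union_union_comm]
  · rintro (j | j)
    · exact h1 j
    · exact h1' j
  · rintro (j | j) (j' | j') hj
    · exact h2 j j' fun e => hj (congrArg Sum.inl e)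
    · exact ⟨horth (he j) _ (he' j'), horth (he j) _ (hf' j'), horth (hf j) _ (he' j'),
        horth (hf j) _ (hf' j')⟩
    · exact ⟨φ.form_comm_zero (horth (he j') _ (he' j)), φ.form_comm_zero (horth (hf j') _ (he' j)),
        φ.form_comm_zero (horth (he j') _ (hf' j)), φ.form_comm_zero (horth (hf j') _ (hf' j))⟩
    · exact h2' j j' fun e => hj (congrArg Sum.inr e)

theorem IsSplitLat.finset_sup {κ : Type} {Lc : κ → Submodule (OH p H) C} {s : Finset κ}
    (h : ∀ i ∈ s, IsSplitLat φ ϖ (Lc i)) (horth : ∀ i j, i ≠ j → Lc i ≤ φ.orthog (Lc j)) :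
    IsSplitLat φ ϖ (⨆ i ∈ s, Lc i) := by
  induction s using Finset.induction_on with
  | empty => simpa using IsSplitLat.bot
  | insert a s ha ih =>
    rw [Finset.iSup_insert, sup_comm]
    refine (ih fun i hi => h i (Finset.mem_insert_of_mem hi)).sup
      (h a (Finset.mem_insert_self a s)) ?_
    exact iSup₂_le fun i hi => horth i a fun e => ha (e ▸ hi)

theorem ModLat.isSplitLat_of_odd [FiniteDimensional H C] {hram : IsRamifiedQuadratic p H conj ϖ}
    {M : Submodule (OH p H) C} {n : ℕ} (hp : p ≠ 2) (hn : Odd n) (h : ModLat hram φ n M) :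
    IsSplitLat φ ϖ M := by
  induction hr : rk M using Nat.strong_induction_on generalizing M with
  | _ r ih =>
  subst hr
  by_cases hM : M = ⊥
  · rw [hM]
    exact IsSplitLat.bot
  obtain ⟨e, he, y, hy, hee, hey⟩ := h.exists_isotropic_of_odd hp (by exact_mod_cast hn) hM
  obtain ⟨f, hf, hw⟩ := h.exists_pair hp he hy hee hey
  have hwM := pairFam_mem he hf
  rw [← h.sup_orthog hw hwM]
  refine IsSplitLat.sup ?_ (ih _ (rk_orthog_lt hw hwM) (h.orthog hw hwM) rfl)
    fun x hx y hy => φ.form_comm_zero (hy.2 x hx)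
  have hff : φ.form f f = 0 := hw.orth false false (by simp)
  have hef : hram.nu (φ.form e f) = lev p n := hw.val true
  have h0 := hram.ne_zero_of_nu hef
  let c := conj (ϖ ^ n / φ.form e f)
  have hc1 : hram.nu c = 1 := by
    simp only [c]
    rw [hram.nu_conj, div_eq_mul_inv, hram.nu_mul, hram.nu_inv, hef, ← zpow_natCast,
      hram.nu_pi_zpow, mul_inv_cancel₀ (lev_pos p n).ne']
  have hc0 : c ≠ 0 := hram.ne_zero_of_nu (hc1.trans (lev_zero p).symm)
  refine isSplitLat_of_fintype (κ := Unit) (fun _ => e) (fun _ => c • f) (fun _ => n) ?_ ?_ ?_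
  · apply le_antisymm
    · rw [Submodule.span_le]
      rintro _ ⟨_ | _, rfl⟩
      · have h1 : pairFam e f false = c⁻¹ • (c • f) := by
          rw [smul_smul, inv_mul_cancel₀ hc0, one_smul]
          rfl
        rw [h1]
        refine smul_mem_of_nu_le hram _ ?_ (Submodule.subset_span (Or.inr ⟨(), rfl⟩))
        rw [hram.nu_inv, hc1, inv_one]
      · exact Submodule.subset_span (Or.inl ⟨(), rfl⟩)
    · rw [Submodule.span_le]
      rintro _ (⟨_, rfl⟩ | ⟨_, rfl⟩)
      · exact Submodule.subset_span ⟨true, rfl⟩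
      · exact smul_mem_of_nu_le hram _ hc1.le (Submodule.subset_span ⟨false, rfl⟩)
  · rintro _
    refine ⟨hee, ?_, ?_⟩
    · rw [φ.form_smul, φ.form_smul_right, hff, mul_zero, mul_zero]
    · rw [φ.form_smul_right]
      simp only [c]
      rw [hram.conj_conj, div_mul_cancel₀ _ h0]
  · intro j j' hj
    exact absurd rfl hj

/-- A split lattice as the span of a monomial family without fixed indices. -/
theorem IsSplitLat.exists_mono (hram : IsRamifiedQuadratic p H conj ϖ) {N : Submodule (OH p H) C}
    (h : IsSplitLat φ ϖ N) :
    ∃ (ι : Type) (_ : Fintype ι) (v : ι → C) (σ : ι → ι) (d : ι → ℕ),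
      Mono hram φ v σ (fun i => d i) ∧ Submodule.span (OH p H) (Set.range v) = N ∧
        ∀ i, σ i ≠ i := by
  obtain ⟨s, e, f, d, rfl, h1, h2⟩ := h
  refine ⟨Fin s ⊕ Fin s, inferInstance, Sum.elim e f, Sum.swap, Sum.elim d d, ⟨?_, ?_, ?_⟩, ?_, ?_⟩
  · exact Sum.swap_swap
  · rintro (i | i) (j | j) hij
    · by_cases h3 : i = j
      · rw [h3]
        exact (h1 j).1
      · exact (h2 i j h3).1
    · exact (h2 i j fun e => hij (congrArg Sum.inr e.symm)).2.1
    · exact (h2 i j fun e => hij (congrArg Sum.inl e.symm)).2.2.1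
    · by_cases h3 : i = j
      · rw [h3]
        exact (h1 j).2.1
      · exact (h2 i j h3).2.2.2
  · have h4 : ∀ i, hram.nu (φ.form (e i) (f i)) = lev p (d i) := by
      intro i
      rw [(h1 i).2.2, ← zpow_natCast, hram.nu_pi_zpow]
    rintro (i | i)
    · exact h4 i
    · exact (φ.nu_form_comm hram _ _).trans (h4 i)
  · rw [Set.Sum.elim_range]
  · rintro (i | i) <;> simp

end Split

section Jordan

variable {p : ℕ} [Fact (Nat.Prime p)] {H : Type} [Field H] [Algebra ℚ_[p] H]
  {conj : H ≃+* H} {ϖ : H} {C : Type} [AddCommGroup C] [Module H C]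
  {φ : HermForm H C conj} {L : Submodule (OH p H) C} {k : ℕ} {Lc : ℕ → Submodule (OH p H) C}

theorem IsLattice.finiteDimensional (hL : IsLattice L) : FiniteDimensional H C := by
  obtain ⟨⟨S, hS⟩, htop⟩ := hL
  rw [← hS, span_span_OH] at htop
  exact ⟨⟨S, htop⟩⟩

theorem IsLattice.eq_zero_of_form (hL : IsLattice L)
    (hnd : ∀ x : C, (∀ y : C, φ.form x y = 0) → x = 0) {x : C}
    (h : ∀ y ∈ L, φ.form x y = 0) : x = 0 := by
  refine hnd x fun y => ?_
  have hy : y ∈ Submodule.span H (L : Set C) := hL.2 ▸ Submodule.mem_top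
  induction hy using Submodule.span_induction with
  | mem y hy => exact h y hy
  | zero => exact φ.form_zero_right x
  | add a b _ _ ha hb => rw [φ.form_add_right, ha, hb, add_zero]
  | smul c a _ ha => rw [φ.form_smul_right, ha, mul_zero]

theorem IsLattice.eq_zero_of_divisible (hram : IsRamifiedQuadratic p H conj ϖ) (hL : IsLattice L)
    (hLint : L ≤ φ.dual L)
    (hnd : ∀ x : C, (∀ y : C, φ.form x y = 0) → x = 0) {x : C}
    (h : ∀ n : ℕ, ∃ y ∈ L, x = ϖ ^ n • y) : x = 0 := by
  refine hL.eq_zero_of_form hnd fun z hz => ?_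
  by_contra h0
  obtain ⟨m, hm⟩ := hram.exists_lev h0
  obtain ⟨y, hy, rfl⟩ := h (m.toNat + 1)
  have h1 := (hram.mem_OH_iff _).1 (hLint hy z hz)
  have h2 : hram.nu (φ.form (ϖ ^ (m.toNat + 1) • y) z) ≤ lev p ((m.toNat + 1 : ℕ) : ℤ) := by
    rw [φ.form_smul, hram.nu_mul, ← zpow_natCast, hram.nu_pi_zpow]
    exact mul_le_of_le_one_right (lev_pos p _).le h1
  rw [hm, lev_le_iff] at h2
  have := Int.self_le_toNat m
  omega

namespace JordanSplitting

theorem le (hJ : JordanSplitting φ ϖ L k Lc) (i : ℕ) : Lc i ≤ L := by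
  by_cases hi : i ≤ k
  · rw [hJ.sup_eq]
    exact le_iSup₂_of_le i (Finset.mem_range.2 (by omega)) le_rfl
  · rw [hJ.bot_of_gt i (by omega)]
    exact bot_le

theorem modLat (hram : IsRamifiedQuadratic p H conj ϖ) (hJ : JordanSplitting φ ϖ L k Lc)
    (hL : IsLattice L) (hLint : L ≤ φ.dual L)
    (hnd : ∀ x : C, (∀ y : C, φ.form x y = 0) → x = 0) (i : ℕ) :
    ModLat hram φ i (Lc i) := by
  by_cases hbot : Lc i = ⊥
  · rw [hbot]
    refine ⟨?_, ?_, ?_⟩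
    · rintro x hx y -
      rw [(Submodule.mem_bot _).1 hx, φ.form_zero, hram.nu_zero]
      exact (lev_pos p _).le
    · intro x hx _
      exact ⟨0, zero_mem _, by rw [(Submodule.mem_bot _).1 hx, smul_zero]⟩
    · intro x hx _
      exact (Submodule.mem_bot _).1 hx
  have hi : i ∈ Finset.range (k + 1) := by
    rw [Finset.mem_range]
    by_contra hc
    exact hbot (hJ.bot_of_gt i (by omega))
  have hmod := hJ.modular i hi hbot
  have hprim : ∀ x ∈ Lc i, x ≠ 0 →
      ∃ (n : ℕ), ∃ x' ∈ Lc i, x' ∉ scale ϖ (Lc i) ∧ x = ϖ ^ n • x' := by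
    intro x hx hx0
    have hex : ∃ n : ℕ, ¬ ∃ y ∈ Lc i, x = ϖ ^ n • y := by
      by_contra! hc
      refine hx0 (hL.eq_zero_of_divisible hram hLint hnd fun n => ?_)
      obtain ⟨y, hy, e⟩ := hc n
      exact ⟨y, hJ.le i hy, e⟩
    obtain ⟨n, hn, hmin⟩ : ∃ n : ℕ, (¬ ∃ y ∈ Lc i, x = ϖ ^ n • y) ∧
        ∀ m < n, ∃ y ∈ Lc i, x = ϖ ^ m • y :=
      ⟨Nat.find hex, Nat.find_spec hex, fun m hm => not_not.1 (Nat.find_min hex hm)⟩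
    rcases Nat.eq_zero_or_pos n with rfl | hpos
    · exact absurd ⟨x, hx, by simp⟩ hn
    obtain ⟨y, hy, e⟩ := hmin (n - 1) (by omega)
    refine ⟨n - 1, y, hy, ?_, e⟩
    rintro ⟨z, hz, rfl⟩
    refine hn ⟨z, hz, ?_⟩
    have h1 : n = n - 1 + 1 := by omega
    rw [e, h1, pow_succ, mul_smul]
    rfl
  have hπ : ∀ m : ℕ, hram.nu (ϖ ^ m) = lev p m := fun m => by
    rw [← zpow_natCast, hram.nu_pi_zpow]
  refine ⟨?_, ?_, ?_⟩
  · intro x hx y hy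
    by_cases hx0 : x = 0
    · rw [hx0, φ.form_zero, hram.nu_zero]
      exact (lev_pos p _).le
    obtain ⟨n, x', hx', hx'p, rfl⟩ := hprim x hx hx0
    have h1 : φ.form x' y ∈ (fun y => φ.form x' y) '' (Lc i : Set C) := ⟨y, hy, rfl⟩
    rw [hmod x' hx' hx'p] at h1
    obtain ⟨c, hc, e⟩ := h1
    rw [φ.form_smul, ← e, hram.nu_mul, hram.nu_mul, hπ, hπ, mul_left_comm]
    refine mul_le_of_le_one_right (lev_pos p _).le (mul_le_one₀ ?_ (hram.nu_nonneg _)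
      ((hram.mem_OH_iff c).1 hc))
    rw [← lev_zero p, lev_le_iff]
    omega
  · intro x hx hxy
    by_cases hx0 : x = 0
    · exact ⟨0, zero_mem _, by rw [hx0, smul_zero]⟩
    obtain ⟨n, x', hx', hx'p, rfl⟩ := hprim x hx hx0
    rcases n with _ | n
    · exfalso
      rw [pow_zero, one_smul] at hxy
      have h1 : ϖ ^ i ∈ (fun c => ϖ ^ i * c) '' ((OH p H : Set H)) :=
        ⟨1, one_mem (OH p H), mul_one _⟩
      rw [← hmod x' hx' hx'p] at h1
      obtain ⟨y, hy, e⟩ := h1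
      have h2 := hxy y hy
      simp only at e
      rw [e, hπ, lev_le_iff] at h2
      omega
    · refine ⟨ϖ ^ (n : ℤ) • x', pi_zpow_smul_mem hram _ (by omega) hx', ?_⟩
      rw [zpow_natCast, smul_smul, pow_succ']
  · intro x hx hxy
    refine hL.eq_zero_of_form hnd fun y hy => φ.form_comm_zero (y := x) (x := y) ?_
    have h1 : L ≤ φ.orthog (Submodule.span (OH p H) {x}) := by
      rw [hJ.sup_eq]
      refine iSup₂_le fun j _ y hy z hz => ?_
      obtain ⟨c, rfl⟩ := Submodule.mem_span_singleton.1 hz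
      rw [oh_smul_def, φ.form_smul_right]
      by_cases hij : i = j
      · subst hij
        rw [φ.form_comm_zero (hxy y hy), mul_zero]
      · rw [hJ.orthog j i (Ne.symm hij) y hy x hx, mul_zero]
    exact h1 hy x (Submodule.mem_span_singleton_self x)

theorem nu_form_le {hram : IsRamifiedQuadratic p H conj ϖ} (hJ : JordanSplitting φ ϖ L k Lc)
    (hmod : ∀ i : ℕ, ModLat hram φ i (Lc i)) {i : ℕ} {x y : C} (hx : x ∈ Lc i) (hy : y ∈ L) :
    hram.nu (φ.form x y) ≤ lev p i := by
  rw [hJ.sup_eq] at hy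
  rw [← Submodule.span_eq (Lc i)] at hx
  rw [Submodule.iSup_eq_span] at hy
  refine φ.nu_form_span_le hram (lev_pos p _).le ?_ hx hy
  intro x hx y hy
  obtain ⟨j, hj⟩ := Set.mem_iUnion.1 hy
  have hj' : y ∈ Lc j ∨ y = 0 := by
    by_cases h : j ∈ Finset.range (k + 1)
    · left
      simpa [h] using hj
    · right
      simpa [h] using hj
  rcases hj' with hj' | rfl
  · by_cases hij : i = j
    · subst hij
      exact (hmod i).int x hx y hj'
    · rw [hJ.orthog i j hij x hx y hj', hram.nu_zero]
      exact (lev_pos p _).le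
  · rw [φ.form_zero_right, hram.nu_zero]
    exact (lev_pos p _).le

end JordanSplitting

end Jordan

end Ramified

namespace Ramified

section Assembly

variable {p : ℕ} [Fact (Nat.Prime p)] {H : Type} [Field H] [Algebra ℚ_[p] H]
  {conj : H ≃+* H} {ϖ : H} {C : Type} [AddCommGroup C] [Module H C]
  {hram : IsRamifiedQuadratic p H conj ϖ}
  {φ : HermForm H C conj} {L : Submodule (OH p H) C} {k : ℕ} {Lc : ℕ → Submodule (OH p H) C}

namespace JordanSplitting

theorem eq_sup_Lge_one (hJ : JordanSplitting φ ϖ L k Lc) : L = Lc 0 ⊔ Lge Lc k 1 := by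
  apply le_antisymm
  · rw [hJ.sup_eq]
    refine iSup₂_le fun i hi => ?_
    rcases Nat.eq_zero_or_pos i with rfl | h0
    · exact le_sup_left
    · refine le_sup_of_le_right (le_iSup₂_of_le i ?_ le_rfl)
      rw [Finset.mem_range] at hi
      rw [Finset.mem_Icc]
      omega
  · exact sup_le (hJ.le 0) (iSup₂_le fun i _ => hJ.le i)

theorem Lge_one_eq_sup (hJ : JordanSplitting φ ϖ L k Lc) :
    Lge Lc k 1 = Lc 1 ⊔ Lge Lc k 2 := by
  apply le_antisymm
  · refine iSup₂_le fun i hi => ?_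
    rw [Finset.mem_Icc] at hi
    by_cases h1 : i = 1
    · rw [h1]
      exact le_sup_left
    · refine le_sup_of_le_right (le_iSup₂_of_le i ?_ le_rfl)
      rw [Finset.mem_Icc]
      omega
  · refine sup_le ?_ (iSup₂_le fun i hi => ?_)
    · by_cases hk : 1 ≤ k
      · exact le_iSup₂_of_le 1 (Finset.mem_Icc.2 ⟨le_rfl, hk⟩) le_rfl
      · rw [hJ.bot_of_gt 1 (by omega)]
        exact bot_le
    · rw [Finset.mem_Icc] at hi
      exact le_iSup₂_of_le i (Finset.mem_Icc.2 ⟨by omega, hi.2⟩) le_rfl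

theorem Lge_le (hJ : JordanSplitting φ ϖ L k Lc) (t : ℕ) : Lge Lc k t ≤ L :=
  iSup₂_le fun i _ => hJ.le i

theorem le_orthog (hJ : JordanSplitting φ ϖ L k Lc) {i j : ℕ} (hij : i ≠ j) :
    Lc i ≤ φ.orthog (Lc j) := fun x hx y hy => hJ.orthog i j hij x hx y hy

theorem nu_form_Lge_one_le (hJ : JordanSplitting φ ϖ L k Lc)
    (hmod : ∀ i : ℕ, ModLat hram φ i (Lc i)) {x y : C} (hx : x ∈ Lge Lc k 1) (hy : y ∈ L) :
    hram.nu (φ.form x y) ≤ lev p 1 := by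
  have h : Lge Lc k 1 ≤ latOf hram φ (fun y : L => (y : C)) fun _ => 1 := by
    refine iSup₂_le fun i hi x hx y => (hJ.nu_form_le hmod hx y.2).trans ?_
    rw [Finset.mem_Icc] at hi
    rw [lev_le_iff]
    show (1 : ℤ) ≤ i
    exact_mod_cast hi.1
  exact h hx ⟨y, hy⟩

variable {ι : ℕ → Type} {v : ∀ i, ι i → C} {σ : ∀ i, ι i → ι i}

theorem mono_sigma (hJ : JordanSplitting φ ϖ L k Lc)
    (hv : ∀ i : ℕ, Mono hram φ (v i) (σ i) fun _ => i)
    (hspan : ∀ i, Submodule.span (OH p H) (Set.range (v i)) = Lc i) (s : Finset ℕ) :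
    Mono hram φ (fun x : Σ i : s, ι i => v x.1 x.2) (fun x => ⟨x.1, σ x.1 x.2⟩)
      (fun x => ((x.1 : ℕ) : ℤ)) := by
  refine Mono.sigma (κ := s) (ι := fun i => ι i) (v := fun i => v i) (σ := fun i => σ i)
    (d := fun i _ => ((i : ℕ) : ℤ)) (fun i => hv i) fun i j hij a b => ?_
  refine hJ.orthog i j (fun e => hij (Subtype.ext e)) _ ?_ _ ?_
  · rw [← hspan]
    exact Submodule.subset_span ⟨a, rfl⟩
  · rw [← hspan]
    exact Submodule.subset_span ⟨b, rfl⟩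

end JordanSplitting

variable {ι : ℕ → Type} {v : ∀ i, ι i → C} {σ : ∀ i, ι i → ι i}

theorem span_sigma (hspan : ∀ i, Submodule.span (OH p H) (Set.range (v i)) = Lc i)
    (s : Finset ℕ) :
    Submodule.span (OH p H) (Set.range fun x : Σ i : s, ι i => v x.1 x.2) = ⨆ i ∈ s, Lc i := by
  rw [Set.range_sigma_eq_iUnion_range, Submodule.span_iUnion, iSup_subtype]
  simp only [hspan]

theorem card_sigma [∀ i, Fintype (ι i)] (hv : ∀ i : ℕ, Mono hram φ (v i) (σ i) fun _ => i)
    (hspan : ∀ i, Submodule.span (OH p H) (Set.range (v i)) = Lc i) (s : Finset ℕ) :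
    Fintype.card (Σ i : s, ι i) = ∑ i ∈ s, rk (Lc i) := by
  rw [Fintype.card_sigma, Finset.sum_coe_sort s fun i => Fintype.card (ι i)]
  refine Finset.sum_congr rfl fun i _ => ?_
  rw [← hspan, (hv i).finrank_span]

theorem rk_Lge_one [∀ i, Fintype (ι i)] (hJ : JordanSplitting φ ϖ L k Lc)
    (hv : ∀ i : ℕ, Mono hram φ (v i) (σ i) fun _ => i)
    (hspan : ∀ i, Submodule.span (OH p H) (Set.range (v i)) = Lc i) :
    rk (Lge Lc k 1) = mOf Lc k := by
  rw [Lge, ← span_sigma hspan, (hJ.mono_sigma hv hspan _).finrank_span, card_sigma hv hspan, mOf]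

theorem JordanSplitting.span_eq_top (hL : IsLattice L) {κ : Type} {w : κ → C}
    (hw : L ≤ Submodule.span (OH p H) (Set.range w)) : Submodule.span H (Set.range w) = ⊤ := by
  rw [eq_top_iff, ← hL.2, ← span_span_OH (p := p) (Set.range w)]
  exact Submodule.span_mono hw

theorem exists_two_vert_of_split [∀ i, Fintype (ι i)] (hJ : JordanSplitting φ ϖ L k Lc)
    (hL : IsLattice L) (hmod : ∀ i : ℕ, ModLat hram φ i (Lc i))
    (hv : ∀ i : ℕ, Mono hram φ (v i) (σ i) fun _ => i)
    (hspan : ∀ i, Submodule.span (OH p H) (Set.range (v i)) = Lc i)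
    (hsplit : IsSplitLat φ ϖ (Lge Lc k 1)) (hex : ∃ i, 2 ≤ i ∧ Nonempty (ι i)) :
    ∃ Λ1 Λ2 : Submodule (OH p H) C, Λ1 ≠ Λ2 ∧ InVert φ ϖ L Λ1 ∧ InVert φ ϖ L Λ2 ∧
      quotCard (φ.dual Λ1) Λ1 = p ^ mOf Lc k ∧ quotCard (φ.dual Λ2) Λ2 = p ^ mOf Lc k := by
  obtain ⟨κ, _, w, τ, d, hw, hwspan, hfix⟩ := hsplit.exists_mono hram
  have hwmem : ∀ j, w j ∈ Lge Lc k 1 := fun j => by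
    rw [← hwspan]
    exact Submodule.subset_span ⟨j, rfl⟩
  have hvmem : ∀ i j, v i j ∈ Lc i := fun i j => by
    rw [← hspan]
    exact Submodule.subset_span ⟨j, rfl⟩
  have hd : ∀ j, 1 ≤ d j := by
    intro j
    have h1 := hJ.nu_form_Lge_one_le hmod (hwmem j) (hJ.Lge_le 1 (hwmem (τ j)))
    rw [hw.val, lev_le_iff] at h1
    exact_mod_cast h1
  have h2 : ∃ j, 2 ≤ d j := by
    by_contra! hc
    have hd1 : (fun j => (d j : ℤ)) = fun _ => 1 := by
      ext j
      have := hd j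
      have := hc j
      omega
    rw [hd1] at hw
    have hM := hw.modLat
    rw [hwspan] at hM
    obtain ⟨i, hi, ⟨a⟩⟩ := hex
    have hik : i ≤ k := by
      by_contra hlt
      have h1 := hvmem i a
      rw [hJ.bot_of_gt i (by omega), Submodule.mem_bot] at h1
      apply (hv i).form_ne_zero a
      rw [h1, φ.form_zero]
    have hle : Lc i ≤ Lge Lc k 1 :=
      le_iSup₂_of_le i (Finset.mem_Icc.2 ⟨by omega, hik⟩) le_rfl
    obtain ⟨y, hy, e⟩ := hM.div _ (hle (hvmem i a)) fun y hy => by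
      refine (hJ.nu_form_le hmod (hvmem i a) (hJ.Lge_le 1 hy)).trans ?_
      rw [lev_le_iff]
      omega
    have h1 := (hv i).val a
    rw [e, φ.form_smul, hram.nu_mul, hram.nu_pi, φ.nu_form_comm hram] at h1
    have h3 := mul_le_mul_of_nonneg_left
      (hJ.nu_form_le hmod (hvmem i (σ i a)) (hJ.Lge_le 1 hy)) (lev_pos p 1).le
    rw [h1, ← lev_add, lev_le_iff] at h3
    omega
  have horth : ∀ i j, φ.form (v 0 i) (w j) = 0 := by
    intro i j
    have h3 : Lge Lc k 1 ≤ φ.orthog (Lc 0) := by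
      refine iSup₂_le fun l hl => hJ.le_orthog ?_
      rw [Finset.mem_Icc] at hl
      omega
    exact φ.form_comm_zero (h3 (hwmem j) _ (hvmem 0 i))
  have hfam := (hv 0).sum hw horth
  have hLspan : L ≤ Submodule.span (OH p H) (Set.range (Sum.elim (v 0) w)) := by
    rw [span_range_sum_elim, hspan, hwspan, ← hJ.eq_sup_Lge_one]
  obtain ⟨Λ1, Λ2, hne, hV1, hV2, hc1, hc2⟩ := hfam.exists_two_vert
    (JordanSplitting.span_eq_top hL hLspan) (by rintro (i | j) <;> simp) hLspan (by
      obtain ⟨j, hj⟩ := h2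
      refine ⟨Sum.inr j, ?_, ?_⟩
      · simpa using hfix j
      · simpa using hj)
  have hcard : (Finset.univ.filter fun i : ι 0 ⊕ κ => Sum.map (σ 0) τ i ≠ i ∧
      1 ≤ Sum.elim (fun _ => ((0 : ℕ) : ℤ)) (fun j => (d j : ℤ)) i).card = mOf Lc k := by
    rw [← rk_Lge_one hJ hv hspan, ← hwspan, hw.finrank_span, Finset.card_filter,
      Fintype.sum_sum_type]
    simp [hfix, Nat.one_le_cast, hd]
  rw [← hcard]
  refine ⟨Λ1, Λ2, hne, hV1, hV2, ?_, ?_⟩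
  · convert hc1
  · convert hc2

end Assembly

end Ramified

namespace Ramified

section Existence

variable {p : ℕ} [Fact (Nat.Prime p)] {H : Type} [Field H] [Algebra ℚ_[p] H]
  {conj : H ≃+* H} {ϖ : H} {C : Type} [AddCommGroup C] [Module H C]
  {hram : IsRamifiedQuadratic p H conj ϖ}
  {φ : HermForm H C conj} {L : Submodule (OH p H) C} {k : ℕ} {Lc : ℕ → Submodule (OH p H) C}

/-- The odd indices `1 ≤ i ≤ k`. -/
def oddIdx (k : ℕ) : Finset ℕ := (Finset.Icc 1 k).filter fun i => Odd i

/-- The even indices `2 ≤ i ≤ k`. -/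
def evenIdx (k : ℕ) : Finset ℕ := (Finset.Icc 2 k).filter fun i => Even i

theorem mem_oddIdx {i : ℕ} : i ∈ oddIdx k ↔ i ≤ k ∧ Odd i := by
  rw [oddIdx, Finset.mem_filter, Finset.mem_Icc]
  constructor
  · exact fun h => ⟨h.1.2, h.2⟩
  · exact fun h => ⟨⟨h.2.pos, h.1⟩, h.2⟩

theorem mem_evenIdx {i : ℕ} : i ∈ evenIdx k ↔ 2 ≤ i ∧ i ≤ k ∧ Even i := by
  rw [evenIdx, Finset.mem_filter, Finset.mem_Icc, and_assoc]

theorem mOf_eq (Lc : ℕ → Submodule (OH p H) C) (k : ℕ) :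
    mOf Lc k = ∑ i ∈ oddIdx k, rk (Lc i) + nEven Lc k := by
  rw [mOf, ← Finset.sum_filter_add_sum_filter_not (Finset.Icc 1 k) (fun i => Odd i), nEven,
    oddIdx]
  congr 1
  refine Finset.sum_congr ?_ fun _ _ => rfl
  ext i
  simp only [Finset.mem_filter, Finset.mem_Icc, Nat.not_odd_iff_even]
  grind

theorem even_card_of_involutive {α : Type*} [Fintype α] {f : α → α} (hf : Function.Involutive f)
    (hne : ∀ i, f i ≠ i) : Even (Fintype.card α) := by
  have h := Equiv.Perm.two_dvd_card_support (σ := hf.toPerm) (by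
    ext i
    simp [sq, hf i])
  have h1 : hf.toPerm.support = Finset.univ := by
    ext i
    simpa using hne i
  rwa [h1, Finset.card_univ, ← even_iff_two_dvd] at h

variable {ι : ℕ → Type} {v : ∀ i, ι i → C} {σ : ∀ i, ι i → ι i}

theorem sigma_ne_of_odd (hv : ∀ i : ℕ, Mono hram φ (v i) (σ i) fun _ => i) {i : ℕ} (hi : Odd i)
    (a : ι i) : σ i a ≠ a := fun h => by
  have h1 := (hv i).even_of_fixed h
  rw [Int.even_coe_nat] at h1
  exact (Nat.not_even_iff_odd.2 hi) h1

theorem even_sum_oddIdx [∀ i, Fintype (ι i)] (hJ : JordanSplitting φ ϖ L k Lc)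
    (hv : ∀ i : ℕ, Mono hram φ (v i) (σ i) fun _ => i)
    (hspan : ∀ i, Submodule.span (OH p H) (Set.range (v i)) = Lc i) :
    Even (∑ i ∈ oddIdx k, rk (Lc i)) := by
  rw [← card_sigma hv hspan]
  refine even_card_of_involutive (f := fun x : Σ i : oddIdx k, ι i => ⟨x.1, σ x.1 x.2⟩)
    (hJ.mono_sigma hv hspan (oddIdx k)).invol ?_
  rintro ⟨⟨i, hi⟩, a⟩ h
  exact sigma_ne_of_odd hv (mem_oddIdx.1 hi).2 a (by simpa using h)

theorem exists_mono_even_part [FiniteDimensional H C] [∀ i, Fintype (ι i)] (hp : p ≠ 2)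
    (hJ : JordanSplitting φ ϖ L k Lc)
    (hv : ∀ i : ℕ, Mono hram φ (v i) (σ i) fun _ => i)
    (hspan : ∀ i, Submodule.span (OH p H) (Set.range (v i)) = Lc i) (h0 : nEven Lc k ≠ 0) :
    ∃ (κ : Type) (_ : Fintype κ) (w : κ → C) (τ : κ → κ), Mono hram φ w τ (fun _ => 2) ∧
      (∀ i ∈ evenIdx k, Lc i ≤ Submodule.span (OH p H) (Set.range w)) ∧
      (∀ i ∉ evenIdx k, ∀ x ∈ Lc i, ∀ j, φ.form x (w j) = 0) ∧
      Fintype.card κ = nEven Lc k ∧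
      (Finset.univ.filter fun i => τ i = i).card = if Odd (nEven Lc k) then 1 else 2 := by
  have hE := hJ.mono_sigma hv hspan (evenIdx k)
  have hR := hE.rescale fun x => 1 - ((x.1 : ℕ) : ℤ) / 2
  have hd : (fun x : Σ i : evenIdx k, ι i => ((x.1 : ℕ) : ℤ) + (1 - ((x.1 : ℕ) : ℤ) / 2) +
      (1 - ((x.1 : ℕ) : ℤ) / 2)) = fun _ => 2 := by
    ext ⟨⟨i, hi⟩, a⟩
    have := (mem_evenIdx.1 hi).2.2
    rw [Nat.even_iff] at this
    simp only
    omega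
  rw [hd] at hR
  have hcard := card_sigma hv hspan (evenIdx k)
  change _ = nEven Lc k at hcard
  have hrk := hR.finrank_span
  rw [hcard] at hrk
  obtain ⟨κ, _, w, τ, hw, hwspan, hfix⟩ := hR.modLat.exists_witt hp (by decide)
    (ModLat.ne_bot_of_rk_ne_zero (by rwa [hrk]))
  rw [hrk] at hfix
  refine ⟨κ, inferInstance, w, τ, hw, fun i hi => ?_, fun i hi x hx j => ?_, ?_, hfix⟩
  · rw [hwspan, ← hspan, Submodule.span_le]
    rintro _ ⟨a, rfl⟩
    have h1 := pi_zpow_smul_mem hram _ (n := (i : ℤ) / 2 - 1)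
      (by have := (mem_evenIdx.1 hi).1; omega)
      (Submodule.subset_span (R := OH p H) (Set.mem_range_self
        (f := fun x : Σ i : evenIdx k, ι i => ϖ ^ (1 - ((x.1 : ℕ) : ℤ) / 2) • v x.1 x.2)
        ⟨⟨i, hi⟩, a⟩))
    simp only at h1
    rw [smul_smul, ← zpow_add₀ hram.pi_ne_zero] at h1
    simpa using h1
  · have hwj : w j ∈ Submodule.span (OH p H) (Set.range w) := Submodule.subset_span ⟨j, rfl⟩
    rw [hwspan] at hwj
    rw [← Submodule.span_eq (Lc i)] at hx
    refine φ.form_span_eq_zero hram ?_ hx hwj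
    rintro y hy _ ⟨⟨⟨l, hl⟩, a⟩, rfl⟩
    have hla : v l a ∈ Lc l := by
      rw [← hspan]
      exact Submodule.subset_span ⟨a, rfl⟩
    simp only
    rw [φ.form_smul_right, hJ.orthog i l (fun e => hi (e ▸ hl)) y hy _ hla, mul_zero]
  · rw [← hw.finrank_span, hwspan, hrk]

theorem exists_two_vert_of_nEven [FiniteDimensional H C] [∀ i, Fintype (ι i)] (hp : p ≠ 2)
    (hJ : JordanSplitting φ ϖ L k Lc) (hL : IsLattice L)
    (hv : ∀ i : ℕ, Mono hram φ (v i) (σ i) fun _ => i)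
    (hspan : ∀ i, Submodule.span (OH p H) (Set.range (v i)) = Lc i) (h0 : nEven Lc k ≠ 0)
    (hcond : 3 ≤ nEven Lc k ∨ ∃ i, 3 ≤ i ∧ i ≤ k ∧ Odd i ∧ Nonempty (ι i)) :
    ∃ Λ1 Λ2 : Submodule (OH p H) C, Λ1 ≠ Λ2 ∧ InVert φ ϖ L Λ1 ∧ InVert φ ϖ L Λ2 ∧
      quotCard (φ.dual Λ1) Λ1 = p ^ (mOf Lc k - if Odd (nEven Lc k) then 1 else 2) ∧
      quotCard (φ.dual Λ2) Λ2 = p ^ (mOf Lc k - if Odd (nEven Lc k) then 1 else 2) := by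
  obtain ⟨κ, _, w, τ, hw, hwle, hworth, hwcard, hwfix⟩ :=
    exists_mono_even_part hp hJ hv hspan h0
  have hO := hJ.mono_sigma hv hspan (oddIdx k)
  have hvmem : ∀ i j, v i j ∈ Lc i := fun i j => by
    rw [← hspan]
    exact Submodule.subset_span ⟨j, rfl⟩
  have hOne : ∀ x : Σ i : oddIdx k, ι i, (⟨x.1, σ x.1 x.2⟩ : Σ i : oddIdx k, ι i) ≠ x := by
    rintro ⟨⟨i, hi⟩, a⟩ h
    exact sigma_ne_of_odd hv (mem_oddIdx.1 hi).2 a (by simpa using h)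
  have hOd : ∀ x : Σ i : oddIdx k, ι i, (1 : ℤ) ≤ ((x.1 : ℕ) : ℤ) := by
    rintro ⟨⟨i, hi⟩, a⟩
    exact_mod_cast (mem_oddIdx.1 hi).2.pos
  have hfam := ((hv 0).sum hO (fun a x => hJ.orthog 0 x.1
    (fun e => by simpa [← e] using (mem_oddIdx.1 x.1.2).2) _ (hvmem _ _) _ (hvmem _ _))).sum hw (by
      rintro (a | ⟨⟨i, hi⟩, a⟩) j
      · exact hworth 0 (fun h => by simpa using (mem_evenIdx.1 h).1) _ (hvmem _ _) j
      · exact hworth i (fun h => Nat.not_even_iff_odd.2 (mem_oddIdx.1 hi).2 (mem_evenIdx.1 h).2.2)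
          _ (hvmem _ _) j)
  have hLspan : L ≤ Submodule.span (OH p H) (Set.range (Sum.elim (Sum.elim (v 0)
      (fun x : Σ i : oddIdx k, ι i => v x.1 x.2)) w)) := by
    rw [span_range_sum_elim, span_range_sum_elim, hspan, span_sigma hspan, hJ.sup_eq]
    refine iSup₂_le fun i hi => ?_
    rw [Finset.mem_range] at hi
    rcases Nat.eq_zero_or_pos i with rfl | hpos
    · exact le_sup_of_le_left le_sup_left
    rcases Nat.even_or_odd i with he | ho
    · refine le_sup_of_le_right (hwle i (mem_evenIdx.2 ⟨?_, by omega, he⟩))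
      rw [Nat.even_iff] at he
      omega
    · exact le_sup_of_le_left (le_sup_of_le_right
        (le_iSup₂_of_le i (mem_oddIdx.2 ⟨by omega, ho⟩) le_rfl))
  have hwadd := Finset.card_filter_add_card_filter_not (s := Finset.univ) fun i => τ i = i
  rw [Finset.card_univ, hwcard, hwfix] at hwadd
  obtain ⟨Λ1, Λ2, hne, hV1, hV2, hc1, hc2⟩ := hfam.exists_two_vert
    (JordanSplitting.span_eq_top hL hLspan) (by rintro ((i | x) | j) <;> simp) hLspan (by
      rcases hcond with h3 | ⟨i, hi3, hik, hio, ⟨a⟩⟩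
      · have h1 : 0 < (Finset.univ.filter fun i => ¬ τ i = i).card := by
          split_ifs at hwadd <;> omega
        obtain ⟨j, hj⟩ := Finset.card_pos.1 h1
        rw [Finset.mem_filter] at hj
        exact ⟨Sum.inr j, by simpa using hj.2, by simp⟩
      · refine ⟨Sum.inl (Sum.inr ⟨⟨i, mem_oddIdx.2 ⟨hik, hio⟩⟩, a⟩), ?_, ?_⟩
        · intro h
          exact hOne ⟨⟨i, mem_oddIdx.2 ⟨hik, hio⟩⟩, a⟩ (Sum.inr_injective (Sum.inl_injective h))
        · simp only [Sum.elim_inl, Sum.elim_inr]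
          omega)
  have hcard : (Finset.univ.filter fun i : (ι 0 ⊕ Σ i : oddIdx k, ι i) ⊕ κ =>
      Sum.map (Sum.map (σ 0) fun x : Σ i : oddIdx k, ι i => ⟨x.1, σ x.1 x.2⟩) τ i ≠ i ∧
      1 ≤ Sum.elim (Sum.elim (fun _ => ((0 : ℕ) : ℤ)) fun x : Σ i : oddIdx k, ι i =>
        ((x.1 : ℕ) : ℤ)) (fun _ => 2) i).card =
      mOf Lc k - if Odd (nEven Lc k) then 1 else 2 := by
    have h1 : ∀ x : Σ i : oddIdx k, ι i,
        ((⟨x.1, σ x.1 x.2⟩ : Σ i : oddIdx k, ι i) = x) = False := fun x => eq_false (hOne x)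
    have h2 : ∀ x : Σ i : oddIdx k, ι i, ((1 : ℤ) ≤ ((x.1 : ℕ) : ℤ)) = True := fun x =>
      eq_true (hOd x)
    rw [mOf_eq, ← card_sigma hv hspan, Finset.card_filter, Fintype.sum_sum_type,
      Fintype.sum_sum_type]
    have h3 : ¬ (1 : ℤ) ≤ 0 := by decide
    have h4 : (1 : ℤ) ≤ 2 := by decide
    simp only [Sum.map_inl, Sum.map_inr, Sum.elim_inl, Sum.elim_inr, ne_eq, Sum.inl.injEq,
      Sum.inr.injEq, h1, h2, h3, h4, not_false_eq_true, and_self, if_true, Nat.cast_zero,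
      and_false, and_true, if_false, Finset.sum_const_zero,
      Finset.sum_const, Finset.card_univ, smul_eq_mul, mul_one, zero_add, ← Finset.card_filter]
    split_ifs at hwadd ⊢ <;> omega
  rw [← hcard]
  refine ⟨Λ1, Λ2, hne, hV1, hV2, ?_, ?_⟩
  · convert hc1
  · convert hc2

end Existence

/-- Let `L` be an integral hermitian `O_H`-lattice with a fixed Jordan
splitting. If (1) `n_even ≥ 3`, or `n_even = 2` and `L_{≥2}` is split; or (2) `n_odd ≥ 2`;
then there are two distinct lattices `Λ₁ ≠ Λ₂` in `Vert(L)` with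
`t(Λ₁) = t(Λ₂) = t(L)`. -/
theorem statement_10 (p : ℕ) [Fact (Nat.Prime p)] (hp : p ≠ 2)
    (H : Type) [Field H] [Algebra ℚ_[p] H] (conj : H ≃+* H) (ϖ : H)
    (hram : IsRamifiedQuadratic p H conj ϖ)
    (C : Type) [AddCommGroup C] [Module H C]
    (φ : HermForm H C conj)
    (hnd : ∀ x : C, (∀ y : C, φ.form x y = 0) → x = 0)
    (L : Submodule (OH p H) C) (k : ℕ) (Lc : ℕ → Submodule (OH p H) C)
    (hL : IsLattice L)
    (hLint : L ≤ φ.dual L)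
    (hJ : JordanSplitting φ ϖ L k Lc)
    (hcond : (3 ≤ nEven Lc k ∨ (nEven Lc k = 2 ∧ IsSplitLat φ ϖ (Lge Lc k 2)))
              ∨ 2 ≤ nOdd Lc k) :
    ∃ Λ1 Λ2 : Submodule (OH p H) C, Λ1 ≠ Λ2 ∧
      InVert φ ϖ L Λ1 ∧ InVert φ ϖ L Λ2 ∧
      quotCard (φ.dual Λ1) Λ1 = p ^ tOf φ ϖ Lc k ∧
      quotCard (φ.dual Λ2) Λ2 = p ^ tOf φ ϖ Lc k := by
  have := hL.finiteDimensional
  have hmod := hJ.modLat hram hL hLint hnd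
  have hex : ∀ i : ℕ, ∃ (ι : Type) (_ : Fintype ι) (v : ι → C) (σ : ι → ι),
      Mono hram φ v σ (fun _ => (i : ℤ)) ∧ Submodule.span (OH p H) (Set.range v) = Lc i := by
    intro i
    rcases Nat.even_or_odd i with he | ho
    · obtain ⟨ι, hι, v, hv⟩ := (hmod i).exists_mono_of_even hp ((Int.even_coe_nat i).2 he)
      exact ⟨ι, hι, v, id, hv⟩
    · exact (hmod i).exists_mono_of_odd hp ((Int.odd_coe_nat i).2 ho)
  choose ι _ v σ hv hspan using hex
  have hne : ∀ i, rk (Lc i) ≠ 0 → Nonempty (ι i) := fun i h => by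
    rw [← hspan, (hv i).finrank_span] at h
    exact Fintype.card_pos_iff.1 (Nat.pos_of_ne_zero h)
  have hodd : 2 ≤ nOdd Lc k → ∃ i, 3 ≤ i ∧ i ≤ k ∧ Odd i ∧ Nonempty (ι i) := fun h => by
    obtain ⟨i, hi, h1⟩ := Finset.exists_ne_zero_of_sum_ne_zero
      (show ∑ i ∈ (Finset.Icc 3 k).filter (fun i => Odd i), rk (Lc i) ≠ 0 by
        change nOdd Lc k ≠ 0
        omega)
    rw [Finset.mem_filter, Finset.mem_Icc] at hi
    exact ⟨i, hi.1.1, hi.1.2, hi.2, hne i h1⟩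
  have heven := even_sum_oddIdx hJ hv hspan
  have hm := mOf_eq Lc k
  unfold tOf
  split_ifs with h1 h2
  · have h3 : Odd (nEven Lc k) := by
      rw [hm] at h1
      exact (Nat.odd_add'.1 h1).2 heven
    have h4 := exists_two_vert_of_nEven hp hJ hL hv hspan h3.pos.ne' (by
      rcases hcond with (h | ⟨h, -⟩) | h
      · exact Or.inl h
      · rw [h] at h3
        exact absurd h3 (by decide)
      · exact Or.inr (hodd h))
    rwa [if_pos h3] at h4
  · refine exists_two_vert_of_split hJ hL hmod hv hspan h2 ?_
    have h3 : nEven Lc k ≠ 0 ∨ 2 ≤ nOdd Lc k := by omega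
    rcases h3 with h3 | h3
    · obtain ⟨i, hi, h4⟩ := Finset.exists_ne_zero_of_sum_ne_zero h3
      rw [Finset.mem_filter, Finset.mem_Icc] at hi
      exact ⟨i, hi.1.1, hne i h4⟩
    · obtain ⟨i, hi, -, -, h4⟩ := hodd h3
      exact ⟨i, by omega, h4⟩
  · have h3 : ¬ Odd (nEven Lc k) := by
      rw [hm] at h1
      exact fun h => h1 (Nat.odd_add'.2 ⟨fun _ => heven, fun _ => h⟩)
    have h4 : nEven Lc k ≠ 0 := by
      intro h4
      refine h2 (IsSplitLat.finset_sup (fun i hi => ?_) fun i j hij => hJ.le_orthog hij)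
      rw [Finset.mem_Icc] at hi
      rcases Nat.even_or_odd i with he | ho
      · have h5 := Finset.sum_eq_zero_iff.1 h4 i (by
          rw [Finset.mem_filter, Finset.mem_Icc]
          rw [Nat.even_iff] at he ⊢
          omega)
        rw [← hspan, (hv i).finrank_span, Fintype.card_eq_zero_iff] at h5
        rw [← hspan, Set.range_eq_empty, Submodule.span_empty]
        exact IsSplitLat.bot
      · exact (hmod i).isSplitLat_of_odd hp ho
    have h5 := exists_two_vert_of_nEven hp hJ hL hv hspan h4 (by
      rcases hcond with (h | ⟨-, h⟩) | h
      · exact Or.inl h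
      · refine absurd ?_ h2
        rw [hJ.Lge_one_eq_sup]
        refine ((hmod 1).isSplitLat_of_odd hp odd_one).sup h fun x hx y hy => ?_
        apply φ.form_comm_zero
        have h6 : Lge Lc k 2 ≤ φ.orthog (Lc 1) := iSup₂_le fun i hi => hJ.le_orthog (by
          rw [Finset.mem_Icc] at hi
          omega)
        exact h6 hy x hx
      · exact Or.inr (hodd h))
    rwa [if_neg h3] at h5

end Ramified
end
end

section
/- Let L be an integral hermitian O_H-lattice with a Jordan splitting L = L_0 ⊕ L_1 ⊕ L_{≥2}, where L_0 is π^0-modular (or zero), L_1 is π^1-modular (or zero), and L_{≥2} is the sum of the components that are π^λ-modular with λ ≥ 2. If Λ ∈ Vert(L) has maximal type, i.e. t(Λ) ≥ t(Λ'') for all Λ'' ∈ Vert(L), then L_0 ⊕ L_1♯ ⊆ Λ, where L_1♯ denotes the dual of L_1 taken inside L_1 ⊗_{O_H} H. -/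
/- Common setup: ramified quadratic extension H/ℚ_p, ring of integers O_H,
   hermitian forms, lattices, duals, vertex lattices. -/

open scoped Classical

noncomputable section

namespace Ramified

section

variable {p : ℕ} [Fact (Nat.Prime p)] {H : Type} [Field H] [Algebra ℚ_[p] H]
  {C : Type} [AddCommGroup C] [Module H C] {conj : H ≃+* H}

theorem mem_OH_iff {a : H} :
    a ∈ OH p H ↔ ((algebraMap ℚ_[p] H).comp PadicInt.Coe.ringHom).IsIntegralElem a :=
  Iff.rfl

theorem algebraMap_mem_OH (z : ℤ_[p]) : algebraMap ℚ_[p] H (z : ℚ_[p]) ∈ OH p H :=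
  mem_OH_iff.2 (((algebraMap ℚ_[p] H).comp PadicInt.Coe.ringHom).isIntegralElem_map)

theorem exists_coe_eq_of_algebraMap_mem_OH {q : ℚ_[p]} (h : algebraMap ℚ_[p] H q ∈ OH p H) :
    ∃ z : ℤ_[p], (z : ℚ_[p]) = q := by
  let : Algebra ℤ_[p] H := ((algebraMap ℚ_[p] H).comp PadicInt.Coe.ringHom).toAlgebra
  have : IsScalarTower ℤ_[p] ℚ_[p] H := IsScalarTower.of_algebraMap_eq fun _ => rfl
  have h' : IsIntegral ℤ_[p] (algebraMap ℚ_[p] H q) := h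
  rw [isIntegral_algebraMap_iff (algebraMap ℚ_[p] H).injective] at h'
  exact IsIntegrallyClosed.isIntegral_iff.1 h'

theorem finite_OH_quotient_span_natCast_p (hfin : FiniteDimensional ℚ_[p] H) :
    Finite (OH p H ⧸ Ideal.span {((p : ℕ) : OH p H)}) := by
  let : Algebra ℤ_[p] H := ((algebraMap ℚ_[p] H).comp PadicInt.Coe.ringHom).toAlgebra
  have : IsScalarTower ℤ_[p] ℚ_[p] H := IsScalarTower.of_algebraMap_eq fun _ => rfl
  have : Module.Finite ℤ_[p] (integralClosure ℤ_[p] H) :=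
    IsIntegralClosure.finite ℤ_[p] ℚ_[p] H (integralClosure ℤ_[p] H)
  have : Finite (ℤ_[p] ⧸ Ideal.span {(p : ℤ_[p])}) := by
    rw [← PadicInt.maximalIdeal_eq_span_p]
    exact Finite.of_equiv _ (PadicInt.residueField (p := p)).symm.toEquiv
  have hQ := Submodule.finite_quotient_smul (Ideal.span {(p : ℤ_[p])})
    (N := (⊤ : Submodule ℤ_[p] (integralClosure ℤ_[p] H))) Module.Finite.fg_top
  let J : Ideal (integralClosure ℤ_[p] H) := Ideal.span {((p : ℕ) : integralClosure ℤ_[p] H)}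
  have hle : Ideal.span {(p : ℤ_[p])} • (⊤ : Submodule ℤ_[p] (integralClosure ℤ_[p] H)) ≤
      J.restrictScalars ℤ_[p] := by
    rw [Submodule.smul_le]
    intro r hr n _
    obtain ⟨c, rfl⟩ := Ideal.mem_span_singleton.1 hr
    refine Ideal.mem_span_singleton.2 ⟨c • n, ?_⟩
    rw [mul_smul, Nat.cast_smul_eq_nsmul, nsmul_eq_mul]
  change Finite (integralClosure ℤ_[p] H ⧸ J.restrictScalars ℤ_[p])
  exact Finite.of_surjective _ (Submodule.factor_surjective hle)

namespace IsRamifiedQuadratic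

variable {ϖ : H}

theorem finiteDimensional (h : IsRamifiedQuadratic p H conj ϖ) : FiniteDimensional ℚ_[p] H :=
  Module.finite_of_finrank_pos (by rw [h.dim_two]; norm_num)

theorem unif_ne_zero (h : IsRamifiedQuadratic p H conj ϖ) : ϖ ≠ 0 := by
  rintro rfl
  have : CharZero H := charZero_of_injective_algebraMap (algebraMap ℚ_[p] H).injective
  obtain ⟨u, hu⟩ := h.unif_sq
  have hp0 : (p : H) ≠ 0 := Nat.cast_ne_zero.2 (Fact.out : p.Prime).ne_zero
  have hu0 : algebraMap ℚ_[p] H ((u : ℤ_[p]) : ℚ_[p]) ≠ 0 := by simp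
  exact mul_ne_zero hu0 hp0 (by rw [← hu, mul_zero])

theorem unif_mem (h : IsRamifiedQuadratic p H conj ϖ) : ϖ ∈ OH p H := by
  let : Algebra ℤ_[p] H := ((algebraMap ℚ_[p] H).comp PadicInt.Coe.ringHom).toAlgebra
  obtain ⟨u, hu⟩ := h.unif_sq
  have h2 : ϖ ^ 2 ∈ OH p H := by
    rw [pow_two, hu]
    exact mul_mem (algebraMap_mem_OH _) (natCast_mem _ _)
  exact IsIntegral.of_pow (R := ℤ_[p]) (n := 2) two_pos h2

theorem conj_mem (h : IsRamifiedQuadratic p H conj ϖ) {a : H} (ha : a ∈ OH p H) :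
    conj a ∈ OH p H := by
  let : Algebra ℤ_[p] H := ((algebraMap ℚ_[p] H).comp PadicInt.Coe.ringHom).toAlgebra
  let f : H →ₐ[ℤ_[p]] H := { conj.toRingHom with commutes' := fun z => h.conj_fix z }
  exact IsIntegral.map f (b := a) ha

theorem natCast_p_eq (h : IsRamifiedQuadratic p H conj ϖ) :
    ∃ c ∈ OH p H, (p : H) = c * ϖ := by
  obtain ⟨u, hu⟩ := h.unif_sq
  refine ⟨algebraMap ℚ_[p] H ((↑u⁻¹ : ℤ_[p]) : ℚ_[p]) * ϖ,
    mul_mem (algebraMap_mem_OH _) h.unif_mem, ?_⟩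
  rw [mul_assoc, hu, ← mul_assoc, ← map_mul, ← PadicInt.coe_mul, Units.inv_mul]
  simp

theorem inv_unif_notMem (h : IsRamifiedQuadratic p H conj ϖ) : ϖ⁻¹ ∉ OH p H := by
  intro hinv
  obtain ⟨u, hu⟩ := h.unif_sq
  have h0 := h.unif_ne_zero
  have : CharZero H := charZero_of_injective_algebraMap (algebraMap ℚ_[p] H).injective
  have hp0 : (p : H) ≠ 0 := Nat.cast_ne_zero.2 (Fact.out : p.Prime).ne_zero
  have hmem : algebraMap ℚ_[p] H ((p : ℚ_[p])⁻¹) ∈ OH p H := by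
    have : algebraMap ℚ_[p] H ((p : ℚ_[p])⁻¹) =
        algebraMap ℚ_[p] H ((u : ℤ_[p]) : ℚ_[p]) * (ϖ⁻¹ * ϖ⁻¹) := by
      rw [map_inv₀, map_natCast, ← mul_inv, eq_mul_inv_iff_mul_eq₀ (mul_ne_zero h0 h0), hu]
      field_simp
    rw [this]
    exact mul_mem (algebraMap_mem_OH _) (mul_mem hinv hinv)
  obtain ⟨z, hz⟩ := exists_coe_eq_of_algebraMap_mem_OH hmem
  have hpp : (p : ℚ_[p]) ≠ 0 := Nat.cast_ne_zero.2 (Fact.out : p.Prime).ne_zero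
  refine PadicInt.prime_p.not_isUnit (IsUnit.of_mul_eq_one z (Subtype.ext ?_))
  push_cast
  rw [hz, mul_inv_cancel₀ hpp]

theorem exists_pow_mul_mem (h : IsRamifiedQuadratic p H conj ϖ) (a : H) :
    ∃ n : ℕ, ϖ ^ n * a ∈ OH p H := by
  let : Algebra ℤ_[p] H := ((algebraMap ℚ_[p] H).comp PadicInt.Coe.ringHom).toAlgebra
  have : IsScalarTower ℤ_[p] ℚ_[p] H := IsScalarTower.of_algebraMap_eq fun _ => rfl
  have := h.finiteDimensional
  have halg : IsAlgebraic ℤ_[p] a :=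
    (IsFractionRing.isAlgebraic_iff ℤ_[p] ℚ_[p] H).2 (Algebra.IsAlgebraic.isAlgebraic a)
  obtain ⟨y, hy0, hy⟩ := halg.exists_integral_multiple
  have hmem : algebraMap ℚ_[p] H (y : ℚ_[p]) * a ∈ OH p H := by
    rw [Algebra.smul_def] at hy
    exact hy
  obtain ⟨u, hu⟩ := h.unif_sq
  set v := PadicInt.unitCoeff hy0
  set m := y.valuation
  have hyv : algebraMap ℚ_[p] H (y : ℚ_[p]) =
      algebraMap ℚ_[p] H ((v : ℤ_[p]) : ℚ_[p]) * (p : H) ^ m := by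
    conv_lhs => rw [PadicInt.unitCoeff_spec hy0]
    simp [v, m]
  have hv : algebraMap ℚ_[p] H ((↑v⁻¹ : ℤ_[p]) : ℚ_[p]) *
      algebraMap ℚ_[p] H ((v : ℤ_[p]) : ℚ_[p]) = 1 := by
    rw [← map_mul, ← PadicInt.coe_mul, Units.inv_mul]
    simp
  refine ⟨2 * m, ?_⟩
  have key : ϖ ^ (2 * m) * a = algebraMap ℚ_[p] H ((u : ℤ_[p]) : ℚ_[p]) ^ m *
      algebraMap ℚ_[p] H ((↑v⁻¹ : ℤ_[p]) : ℚ_[p]) *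
      (algebraMap ℚ_[p] H (y : ℚ_[p]) * a) := by
    rw [pow_mul, pow_two, hu, mul_pow, hyv]
    linear_combination (-(algebraMap ℚ_[p] H ((u : ℤ_[p]) : ℚ_[p]) ^ m * (p : H) ^ m * a)) * hv
  rw [key]
  exact mul_mem (mul_mem (pow_mem (algebraMap_mem_OH _) _) (algebraMap_mem_OH _)) hmem

end IsRamifiedQuadratic

theorem smul_mem_of_mem_OH {N : Submodule (OH p H) C} {a : H} (ha : a ∈ OH p H) {x : C}
    (hx : x ∈ N) : a • x ∈ N :=
  N.smul_mem (⟨a, ha⟩ : OH p H) hx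

theorem exists_pow_smul_mem_of_mem_span {ϖ : H} (h : IsRamifiedQuadratic p H conj ϖ)
    {M : Submodule (OH p H) C} {x : C} (hx : x ∈ Submodule.span H (M : Set C)) :
    ∃ n : ℕ, ϖ ^ n • x ∈ M := by
  induction hx using Submodule.span_induction with
  | mem x hx => exact ⟨0, by simpa using hx⟩
  | zero => exact ⟨0, by simp⟩
  | add x y _ _ hx hy =>
    obtain ⟨m, hm⟩ := hx
    obtain ⟨n, hn⟩ := hy
    refine ⟨m + n, ?_⟩
    rw [smul_add]
    refine add_mem ?_ ?_
    · rw [add_comm, pow_add, mul_smul]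
      exact smul_mem_of_mem_OH (pow_mem h.unif_mem _) hm
    · rw [pow_add, mul_smul]
      exact smul_mem_of_mem_OH (pow_mem h.unif_mem _) hn
  | smul a x _ hx =>
    obtain ⟨m, hm⟩ := hx
    obtain ⟨n, hn⟩ := h.exists_pow_mul_mem a
    refine ⟨n + m, ?_⟩
    have : ϖ ^ (n + m) • a • x = (ϖ ^ n * a) • ϖ ^ m • x := by
      simp only [smul_smul]
      congr 1
      ring
    rw [this]
    exact smul_mem_of_mem_OH hn hm

/-- If `M` is `ϖ`-modular, then `ϖ` maps the dual of `M` (in its `H`-span) into `M`. -/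
theorem IsPiModular.unif_smul_mem {φ : HermForm H C conj} {ϖ : H}
    (h : IsRamifiedQuadratic p H conj ϖ) {M : Submodule (OH p H) C}
    (hM : IsPiModular φ ϖ ϖ M) {x : C} (hx : x ∈ Submodule.span H (M : Set C))
    (hdual : x ∈ φ.dual M) : ϖ • x ∈ M := by
  have h0 := h.unif_ne_zero
  have descend : ∀ n : ℕ, ϖ ^ (n + 1) • x ∈ M → ϖ • x ∈ M := by
    intro n
    induction n with
    | zero => simp
    | succ n ih =>
      intro hn
      refine ih ?_
      by_cases hs : ϖ ^ (n + 1 + 1) • x ∈ scale ϖ M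
      · obtain ⟨z, hz, hzx⟩ := hs
        have hzx : ϖ • z = ϖ ^ (n + 1 + 1) • x := hzx
        rw [pow_succ', mul_smul] at hzx
        rwa [← smul_right_injective C h0 hzx]
      · obtain ⟨y, hy, hyx⟩ : ϖ ∈ (fun y => φ.form (ϖ ^ (n + 1 + 1) • x) y) '' (M : Set C) := by
          rw [hM _ hn hs]
          exact ⟨1, one_mem _, mul_one _⟩
        refine absurd ?_ h.inv_unif_notMem
        have hinv : ϖ⁻¹ = ϖ ^ n * φ.form x y := by
          have hyx : φ.form (ϖ ^ (n + 1 + 1) • x) y = ϖ := hyx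
          rw [φ.form_smul] at hyx
          refine inv_eq_of_mul_eq_one_left ?_
          exact mul_right_cancel₀ h0 (by linear_combination hyx)
        rw [hinv]
        exact mul_mem (pow_mem h.unif_mem _) (hdual y hy)
  obtain ⟨n, hn⟩ := exists_pow_smul_mem_of_mem_span h hx
  refine descend n ?_
  rw [pow_succ', mul_smul]
  exact smul_mem_of_mem_OH h.unif_mem hn

theorem HermForm.form_add_right_s11 (φ : HermForm H C conj) (x y z : C) :
    φ.form x (y + z) = φ.form x y + φ.form x z := by
  rw [φ.form_conj (y + z), φ.form_add, map_add, ← φ.form_conj, ← φ.form_conj]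

theorem HermForm.form_smul_right_s11 (φ : HermForm H C conj) (a : H) (x y : C) :
    φ.form x (a • y) = conj a * φ.form x y := by
  rw [φ.form_conj (a • y), φ.form_smul, map_mul, ← φ.form_conj]

theorem HermForm.dual_anti (φ : HermForm H C conj) {M N : Submodule (OH p H) C} (hMN : M ≤ N) :
    φ.dual N ≤ φ.dual M :=
  fun _ hx y hy => hx y (hMN hy)

theorem HermForm.mem_dual_sup_span {φ : HermForm H C conj} {ϖ : H}
    (h : IsRamifiedQuadratic p H conj ϖ) {M : Submodule (OH p H) C} {x z : C}
    (hM : z ∈ φ.dual M) (hx : φ.form z x ∈ OH p H) :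
    z ∈ φ.dual (M ⊔ Submodule.span (OH p H) {x}) := by
  intro y hy
  obtain ⟨m, hm, w, hw, rfl⟩ := Submodule.mem_sup.1 hy
  obtain ⟨c, rfl⟩ := Submodule.mem_span_singleton.1 hw
  rw [φ.form_add_right_s11, oh_smul_def, φ.form_smul_right_s11]
  exact add_mem (hM m hm) (mul_mem (h.conj_mem c.2) hx)

theorem HermForm.form_eq_zero_of_mem_span {φ : HermForm H C conj} {S : Set C} {z x : C}
    (hz : ∀ y ∈ S, φ.form z y = 0) (hx : x ∈ Submodule.span H S) : φ.form z x = 0 := by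
  induction hx using Submodule.span_induction with
  | mem x hx => exact hz x hx
  | zero => rw [φ.form_conj, φ.form_zero, map_zero]
  | add x y _ _ hx hy => rw [φ.form_add_right_s11, hx, hy, add_zero]
  | smul a x _ hx => rw [φ.form_smul_right_s11, hx, mul_zero]

theorem quotCard_eq_relIndex (N M : Submodule (OH p H) C) :
    quotCard N M = N.toAddSubgroup.relIndex M.toAddSubgroup :=
  rfl

theorem quotCard_ne_zero {ϖ : H} (h : IsRamifiedQuadratic p H conj ϖ)
    {N M : Submodule (OH p H) C} (hfg : M.FG) (hle : scale ϖ M ≤ N) : quotCard N M ≠ 0 := by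
  have := finite_OH_quotient_span_natCast_p h.finiteDimensional
  have : Module.Finite (OH p H) M := Module.Finite.iff_fg.2 hfg
  have hQ := Submodule.finite_quotient_smul (Ideal.span {((p : ℕ) : OH p H)})
    (N := (⊤ : Submodule (OH p H) M)) Module.Finite.fg_top
  have hsub : Ideal.span {((p : ℕ) : OH p H)} • (⊤ : Submodule (OH p H) M) ≤
      N.comap M.subtype := by
    rw [Submodule.smul_le]
    intro r hr m _
    obtain ⟨c, rfl⟩ := Ideal.mem_span_singleton.1 hr
    obtain ⟨d, hd, hpd⟩ := h.natCast_p_eq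
    have : M.subtype ((((p : ℕ) : OH p H) * c) • m) = ((c : H) * d) • ϖ • (m : C) := by
      change (((((p : ℕ) : OH p H) * c : OH p H) : H)) • (m : C) = _
      rw [smul_smul]
      congr 1
      push_cast
      rw [hpd]
      ring
    rw [Submodule.mem_comap, this]
    exact smul_mem_of_mem_OH (mul_mem c.2 hd) (hle ⟨m, m.2, rfl⟩)
  have := Finite.of_surjective _ (Submodule.factor_surjective hsub)
  exact Nat.card_pos.ne'

theorem quotCard_lt_of_lt {N' N M M' : Submodule (OH p H) C} (h1 : N' ≤ N) (h2 : N ≤ M)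
    (h3 : M < M') (h0 : quotCard N' M' ≠ 0) : quotCard N M < quotCard N' M' := by
  simp only [quotCard_eq_relIndex] at h0 ⊢
  have e1 := AddSubgroup.relIndex_mul_relIndex N'.toAddSubgroup M.toAddSubgroup M'.toAddSubgroup
    (h1.trans h2) h3.le
  have e2 := AddSubgroup.relIndex_mul_relIndex N'.toAddSubgroup N.toAddSubgroup M.toAddSubgroup
    h1 h2
  have hne : M.toAddSubgroup.relIndex M'.toAddSubgroup ≠ 1 := fun h =>
    h3.not_ge (AddSubgroup.relIndex_eq_one.1 h)
  rw [← e1, ← e2] at h0 ⊢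
  obtain ⟨h0, hc⟩ := mul_ne_zero_iff.1 h0
  obtain ⟨ha, hb⟩ := mul_ne_zero_iff.1 h0
  generalize N'.toAddSubgroup.relIndex N.toAddSubgroup = a at *
  generalize N.toAddSubgroup.relIndex M.toAddSubgroup = b at *
  generalize M.toAddSubgroup.relIndex M'.toAddSubgroup = c at *
  have : 2 ≤ c := by omega
  have : 1 ≤ a := by omega
  have : 1 ≤ b := by omega
  nlinarith [Nat.le_mul_of_pos_left b this]

/-- Adjoining to `Λ ∈ Vert(L)` a vector `x` with `ϖx ∈ L`, `(x, L) ⊆ O_H` gives an element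
of `Vert(L)`. -/
theorem InVert.sup_span {φ : HermForm H C conj} {ϖ : H} (h : IsRamifiedQuadratic p H conj ϖ)
    {L Λ : Submodule (OH p H) C} (hΛ : InVert φ ϖ L Λ) {x : C} (hϖx : ϖ • x ∈ L)
    (hx : ∀ z ∈ L, φ.form z x ∈ OH p H) :
    InVert φ ϖ L (Λ ⊔ Submodule.span (OH p H) {x}) := by
  obtain ⟨⟨⟨hfg, hspan⟩, hscale, hdual⟩, hL⟩ := hΛ
  refine ⟨⟨⟨hfg.sup (Submodule.fg_span_singleton x), ?_⟩, ?_, ?_⟩, fun z hz =>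
    HermForm.mem_dual_sup_span h (hL hz) (hx z hz)⟩
  · rw [eq_top_iff, ← hspan]
    exact Submodule.span_mono fun _ hy => Submodule.mem_sup_left hy
  · rintro _ ⟨y, hy, rfl⟩
    obtain ⟨m, hm, w, hw, rfl⟩ := Submodule.mem_sup.1 hy
    obtain ⟨c, rfl⟩ := Submodule.mem_span_singleton.1 hw
    rw [map_add, map_smul]
    refine add_mem (HermForm.mem_dual_sup_span h (hscale ⟨m, hm, rfl⟩) ?_)
      (Submodule.smul_mem _ _ (HermForm.mem_dual_sup_span h (hL hϖx) (hx _ hϖx)))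
    have hm' : φ.form (ϖ • m) x = -conj (φ.form (ϖ • x) m) := by
      rw [← φ.form_conj, φ.form_smul_right_s11, h.conj_unif, φ.form_smul]
      ring
    change φ.form (ϖ • m) x ∈ OH p H
    rw [hm']
    exact neg_mem (h.conj_mem (hL hϖx m hm))
  · exact (φ.dual_anti le_sup_left).trans (hdual.trans le_sup_left)

end

/-- Let `L` be an integral hermitian `O_H`-lattice with a Jordan
splitting `L = L₀ ⊕ L₁ ⊕ L_{≥2}`. If `Λ ∈ Vert(L)` has maximal type among all members of
`Vert(L)`, then `L₀ ⊕ L₁♯ ⊆ Λ`, where `L₁♯` is the dual of `L₁` inside `L₁ ⊗_{O_H} H`. -/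
theorem statement_11 (p : ℕ) [Fact (Nat.Prime p)] (hp : p ≠ 2)
    (H : Type) [Field H] [Algebra ℚ_[p] H] (conj : H ≃+* H) (ϖ : H)
    (hram : IsRamifiedQuadratic p H conj ϖ)
    (C : Type) [AddCommGroup C] [Module H C]
    (φ : HermForm H C conj)
    (hnd : ∀ x : C, (∀ y : C, φ.form x y = 0) → x = 0)
    (L : Submodule (OH p H) C) (k : ℕ) (Lc : ℕ → Submodule (OH p H) C)
    (hL : IsLattice L)
    (hLint : L ≤ φ.dual L)
    (hJ : JordanSplitting φ ϖ L k Lc)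
    (Λ : Submodule (OH p H) C)
    (hΛ : InVert φ ϖ L Λ)
    (hmax : ∀ Λ'' : Submodule (OH p H) C, InVert φ ϖ L Λ'' →
      quotCard (φ.dual Λ'') Λ'' ≤ quotCard (φ.dual Λ) Λ) :
    Lc 0 ⊔ (φ.dual (Lc 1) ⊓ restrictOH (Submodule.span H ((Lc 1 : Set C)))) ≤ Λ := by
  have h0 := hram.unif_ne_zero
  have hle : ∀ i ≤ k, Lc i ≤ L := fun i hi => by
    rw [hJ.sup_eq]
    exact le_biSup Lc (Finset.mem_range.2 (by omega))
  refine sup_le ((hle 0 k.zero_le).trans (hΛ.2.trans hΛ.1.2.2)) ?_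
  rintro x ⟨hxd, hxs⟩
  have hxs : x ∈ Submodule.span H (Lc 1 : Set C) := hxs
  by_cases hbot : Lc 1 = ⊥
  · rw [hbot, Submodule.bot_coe, Submodule.span_zero_singleton, Submodule.mem_bot] at hxs
    rw [hxs]
    exact zero_mem _
  have hk : 1 ≤ k := by
    by_contra! hk
    exact hbot (hJ.bot_of_gt 1 hk)
  have hmod := hJ.modular 1 (Finset.mem_range.2 (by omega)) hbot
  rw [pow_one] at hmod
  have hϖx : ϖ • x ∈ L := hle 1 hk (hmod.unif_smul_mem hram hxs hxd)
  have hLx : L ≤ φ.dual (Submodule.span (OH p H) {x}) := by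
    rw [hJ.sup_eq]
    refine iSup₂_le fun i _ z hz => ?_
    have hzx : φ.form z x ∈ OH p H := by
      rcases eq_or_ne i 1 with rfl | hi
      · rw [φ.form_conj x z]
        exact hram.conj_mem (hxd z hz)
      · rw [HermForm.form_eq_zero_of_mem_span (hJ.orthog i 1 hi z hz) hxs]
        exact zero_mem _
    have hz0 : z ∈ φ.dual (⊥ : Submodule (OH p H) C) := by
      intro y hy
      rw [(Submodule.mem_bot _).1 hy, φ.form_conj 0, φ.form_zero, map_zero]
      exact zero_mem _
    simpa using HermForm.mem_dual_sup_span hram hz0 hzx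
  have hVert := hΛ.sup_span hram hϖx fun z hz => hLx hz x (Submodule.mem_span_singleton_self x)
  by_contra hx
  refine (hmax _ hVert).not_gt (quotCard_lt_of_lt (φ.dual_anti le_sup_left) hΛ.1.2.2 ?_
    (quotCard_ne_zero hram hVert.1.1.1 hVert.1.2.1))
  exact left_lt_sup.2 fun hle => hx (hle (Submodule.mem_span_singleton_self x))

end Ramified
end
end
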